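/- The problem of deciding, given a non-deterministic Turing machine M and a state q_r of M, whether M is universally non-recurring through q_r (i.e., for every input word w, every run of M on w features q_r only finitely many times) is Π¹₁-complete. -/

import Mathlib

/-!
Common formalization framework for "Restricted Chase Termination: You Want More than Fairness"
(Carral, Gerlach, Larroque, Thomazo).

Syntax is encoded over natural numbers so that all finite objects (rules, databases, knowledge
bases, Turing machines) live in `Primcodable` types, which allows us to speak about
many-one reductions and about the arithmetical/analytical hierarchy.
-/

namespace ChaseTermination

/-! ### Terms, atoms, facts, rules, knowledge bases -/

/-- Ground terms: `Sum.inl c` is the constant `c`, `Sum.inr n` is the null `n`. -/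
abbrev GroundTerm : Type := ℕ ⊕ ℕ

/-- Terms of rules: `Sum.inl v` is the variable `v`, `Sum.inr g` a ground term. -/
abbrev RTerm : Type := ℕ ⊕ GroundTerm

/-- A fact: a predicate (coded by a natural number) applied to ground terms. -/
abbrev Fact : Type := ℕ × List GroundTerm

/-- An atom: a predicate applied to terms. -/
abbrev Atom : Type := ℕ × List RTerm

/-- An existential rule, given by its body and its head (lists of atoms);
the universally quantified variables are those occurring in the body, the existentially
quantified ones are the head variables not occurring in the body. -/
abbrev Rule : Type := List Atom × List Atom

abbrev RuleSet : Type := List Rule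

abbrev Database : Type := List Fact

/-- A knowledge base: a (finite) rule set together with a database. -/
abbrev KB : Type := RuleSet × Database

def atomHasVar (a : Atom) (v : ℕ) : Prop := (Sum.inl v : RTerm) ∈ a.2

def atomNullFree (a : Atom) : Prop := ∀ t ∈ a.2, ∀ n : ℕ, t ≠ Sum.inr (Sum.inr n)

def factNullFree (f : Fact) : Prop := ∀ t ∈ f.2, ∀ n : ℕ, t ≠ Sum.inr n

/-- A database is a finite fact set without nulls. -/
def IsDatabase (D : Database) : Prop := ∀ f ∈ D, factNullFree f

/-- Well-formed rule: non-empty head, no nulls. -/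
def IsRule (r : Rule) : Prop := r.2 ≠ [] ∧ ∀ a ∈ r.1 ++ r.2, atomNullFree a

def IsRuleSet (S : RuleSet) : Prop := ∀ r ∈ S, IsRule r

def IsKB (kb : KB) : Prop := IsRuleSet kb.1 ∧ IsDatabase kb.2

/-- `v` occurs in the body of `r` (i.e. is universally quantified). -/
def bodyVar (r : Rule) (v : ℕ) : Prop := ∃ a ∈ r.1, atomHasVar a v

/-- `v` is an existential variable of `r`. -/
def existVar (r : Rule) (v : ℕ) : Prop := (∃ a ∈ r.2, atomHasVar a v) ∧ ¬ bodyVar r v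

def applyT (σ : ℕ → GroundTerm) : RTerm → GroundTerm
  | Sum.inl v => σ v
  | Sum.inr g => g

def applyA (σ : ℕ → GroundTerm) (a : Atom) : Fact := (a.1, a.2.map (applyT σ))

/-- A trigger: a rule together with a substitution for its (universal) variables. -/
abbrev Trigger : Type := Rule × (ℕ → GroundTerm)

/-- The support of a trigger: the instantiated body. -/
def support (t : Trigger) : Set Fact := {f | ∃ a ∈ t.1.1, f = applyA t.2 a}

/-- A trigger is loaded for `F` if `F` includes its support. -/
def loaded (t : Trigger) (F : Set Fact) : Prop := ∀ a ∈ t.1.1, applyA t.2 a ∈ F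

/-- `σ'` agrees with the substitution of `t` on all universally quantified (body) variables. -/
def agreesOnBody (t : Trigger) (σ' : ℕ → GroundTerm) : Prop :=
  ∀ v, bodyVar t.1 v → σ' v = t.2 v

/-- A trigger is obsolete for `F` if some extension of its substitution to the existential
variables sends the head into `F`. -/
def obsolete (t : Trigger) (F : Set Fact) : Prop :=
  ∃ σ' : ℕ → GroundTerm, agreesOnBody t σ' ∧ ∀ a ∈ t.1.2, applyA σ' a ∈ F

/-- The (ground) terms occurring in a fact set. -/
def termsOf (F : Set Fact) : Set GroundTerm := {g | ∃ f ∈ F, g ∈ f.2}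

/-- `σ'` is a proper output extension of the trigger `t` w.r.t. `F`: it agrees with the trigger
substitution on body variables and maps existential variables to pairwise distinct fresh nulls. -/
def properExt (t : Trigger) (F : Set Fact) (σ' : ℕ → GroundTerm) : Prop :=
  agreesOnBody t σ' ∧
  (∀ v, existVar t.1 v → ∃ n : ℕ, σ' v = Sum.inr n ∧ (Sum.inr n : GroundTerm) ∉ termsOf F) ∧
  (∀ v w, existVar t.1 v → existVar t.1 w → σ' v = σ' w → v = w)

/-- The output of a trigger under an extended substitution. -/
def outputOf (t : Trigger) (σ' : ℕ → GroundTerm) : Set Fact := {f | ∃ a ∈ t.1.2, f = applyA σ' a}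

/-- An active trigger of `S` for `F`: loaded and not obsolete. -/
def Active (S : RuleSet) (F : Set Fact) (t : Trigger) : Prop :=
  t.1 ∈ S ∧ loaded t F ∧ ¬ obsolete t F

/-- One restricted chase step. -/
def ChaseStep (S : RuleSet) (F F' : Set Fact) : Prop :=
  ∃ t : Trigger, Active S F t ∧ ∃ σ', properExt t F σ' ∧ F' = F ∪ outputOf t σ'

def dbSet (D : Database) : Set Fact := {f | f ∈ D}

/-- A (possibly infinite) restricted chase derivation for `⟨S, D⟩`, of length `len ∈ ℕ∞`.
Beyond the length the fact sets stall, so that the result is always `⋃ i, fact i`. -/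
structure Chase (S : RuleSet) (D : Set Fact) where
  len : ℕ∞
  fact : ℕ → Set Fact
  trig : ℕ → Trigger
  ext : ℕ → ℕ → GroundTerm
  init : fact 0 = D
  activeAt : ∀ i : ℕ, (i : ℕ∞) < len → Active S (fact i) (trig i)
  extOk : ∀ i : ℕ, (i : ℕ∞) < len → properExt (trig i) (fact i) (ext i)
  succ : ∀ i : ℕ, (i : ℕ∞) < len → fact (i + 1) = fact i ∪ outputOf (trig i) (ext i)
  stall : ∀ i : ℕ, ¬ ((i : ℕ∞) < len) → fact (i + 1) = fact i

/-- Fairness: every trigger that becomes loaded is eventually obsolete.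
A fair chase derivation is a *restricted chase sequence*; note that for a finite derivation
fairness forces maximality (no active trigger remains at the end). -/
def Fair {S : RuleSet} {D : Set Fact} (c : Chase S D) : Prop :=
  ∀ t : Trigger, t.1 ∈ S → ∀ i : ℕ, loaded t (c.fact i) → ∃ j : ℕ, i ≤ j ∧ obsolete t (c.fact j)

/-- The result of a chase derivation. -/
def chaseResult {S : RuleSet} {D : Set Fact} (c : Chase S D) : Set Fact := ⋃ i, c.fact i

/-- The derivation is infinite (non-terminating). -/
def IsInfinite {S : RuleSet} {D : Set Fact} (c : Chase S D) : Prop := c.len = ⊤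

/-- `TKR∀`: knowledge bases all of whose restricted chase sequences are finite. -/
def TKRall (kb : KB) : Prop :=
  IsKB kb ∧ ¬ ∃ c : Chase kb.1 (dbSet kb.2), IsInfinite c ∧ Fair c

/-- `TRR∀`: rule sets universally terminating for the restricted chase on every database. -/
def TRRall (S : RuleSet) : Prop :=
  IsRuleSet S ∧ ∀ D : Database, IsDatabase D → ¬ ∃ c : Chase S (dbSet D), IsInfinite c ∧ Fair c

/-! ### Breadth-first chase -/

/-- The instance of a trigger: its rule together with its instantiated body (this determines the
substitution on all body variables). -/
def instOf (t : Trigger) : Rule × List Fact := (t.1, t.1.1.map (applyA t.2))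

/-- The set of instances of active triggers (this is what "the number of triggers that are loaded
and not obsolete" counts). -/
def activeInsts (S : RuleSet) (F : Set Fact) : Set (Rule × List Fact) :=
  {p | ∃ t : Trigger, Active S F t ∧ p = instOf t}

/-- The breadth-first condition (†): a trigger loaded at step `i` becomes obsolete within the
next `n` steps, where `n` is the number of active triggers at step `i`. -/
def BreadthFirst {S : RuleSet} {D : Set Fact} (c : Chase S D) : Prop :=
  ∀ i : ℕ, ∀ t : Trigger, t.1 ∈ S → loaded t (c.fact i) →
    ∃ j : ℕ, i ≤ j ∧ j ≤ i + (activeInsts S (c.fact i)).ncard ∧ obsolete t (c.fact j)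

/-- `TKRBF∀`: knowledge bases all of whose breadth-first chase sequences are finite. -/
def TKRBFall (kb : KB) : Prop :=
  IsKB kb ∧ ¬ ∃ c : Chase kb.1 (dbSet kb.2), IsInfinite c ∧ BreadthFirst c

/-- `TRRBF∀`: rule sets whose breadth-first chase terminates on every database. -/
def TRRBFall (S : RuleSet) : Prop :=
  IsRuleSet S ∧ ∀ D : Database, IsDatabase D →
    ¬ ∃ c : Chase S (dbSet D), IsInfinite c ∧ BreadthFirst c

/-! ### Classes of the arithmetical and analytical hierarchies -/

/-- `Π⁰₂` predicates, via the Kleene normal form `∀ m ∃ k. R`. -/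
def Pi02 {α : Type} [Primcodable α] (p : α → Prop) : Prop :=
  ∃ R : α × ℕ → ℕ → Bool, Computable₂ R ∧ ∀ a, p a ↔ ∀ m : ℕ, ∃ k : ℕ, R (a, m) k = true

/-- `Π¹₁` predicates, via the Kleene normal form: `p a` iff for every function `f : ℕ → ℕ` some
finite initial segment of `f` witnesses a computable predicate. -/
def Pi11 {α : Type} [Primcodable α] (p : α → Prop) : Prop :=
  ∃ R : α → List ℕ → Bool, Computable₂ R ∧
    ∀ a, p a ↔ ∀ f : ℕ → ℕ, ∃ k : ℕ, R a ((List.range k).map f) = true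

/-- `Π¹₁`-hardness: every `Π¹₁` problem many-one reduces to `p`. -/
def Pi11Hard {α : Type} [Primcodable α] (p : α → Prop) : Prop :=
  ∀ q : ℕ → Prop, Pi11 q → q ≤₀ p

def Pi11Complete {α : Type} [Primcodable α] (p : α → Prop) : Prop := Pi11 p ∧ Pi11Hard p

/-! ### Non-deterministic Turing machines -/

/-- A non-deterministic Turing machine `(numStates, alphaSize, table)`.
States are `0, …, numStates - 1` with initial state `0`; tape symbols `0, …, alphaSize - 1`
form `Γ` (so `{0,1} ⊆ Γ` iff `2 ≤ alphaSize`), and the blank `B` is coded by `alphaSize`.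
An entry `((q, a), (q', b, d))` means `(q', b, d) ∈ δ(q, a)`, with `d = true` for a right move
and `d = false` for a left move. -/
abbrev NTM : Type := ℕ × ℕ × List ((ℕ × ℕ) × (ℕ × ℕ × Bool))

def NTM.numStates (M : NTM) : ℕ := M.1
def NTM.blank (M : NTM) : ℕ := M.2.1
def NTM.table (M : NTM) : List ((ℕ × ℕ) × (ℕ × ℕ × Bool)) := M.2.2

/-- Well-formedness: `Γ ⊇ {0,1}`, transitions use valid states and symbols, and the machine
never writes the blank. -/
def NTM.WF (M : NTM) : Prop :=
  1 ≤ NTM.numStates M ∧ 2 ≤ NTM.blank M ∧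
    ∀ e ∈ NTM.table M, e.1.1 < NTM.numStates M ∧ e.1.2 ≤ NTM.blank M ∧
      e.2.1 < NTM.numStates M ∧ e.2.2.1 < NTM.blank M

/-- A configuration `(tape, p, q)`: tape contents (a list of symbol codes whose last cell is
blank and in which no proper symbol occurs after a blank), 0-based head position `p`,
and current state `q`. -/
abbrev Config : Type := List ℕ × ℕ × ℕ

def WFConfig (M : NTM) (ρ : Config) : Prop :=
  ρ.2.1 < ρ.1.length ∧ ρ.1.getLast? = some (NTM.blank M) ∧
    (∀ i j : ℕ, i ≤ j → j < ρ.1.length → ρ.1.getD i 0 = NTM.blank M →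
      ρ.1.getD j 0 = NTM.blank M) ∧
    (∀ a ∈ ρ.1, a ≤ NTM.blank M) ∧ ρ.2.2 < NTM.numStates M

/-- The one-step relation `Next_M` between configurations; each step extends the represented
part of the tape by one blank cell. -/
def NTM.Next (M : NTM) (ρ ρ' : Config) : Prop :=
  ∃ q' b : ℕ, ∃ d : Bool,
    ((ρ.2.2, ρ.1.getD ρ.2.1 0), (q', b, d)) ∈ NTM.table M ∧
    (d = true ∨ 1 ≤ ρ.2.1) ∧
    ρ' = (ρ.1.set ρ.2.1 b ++ [NTM.blank M], if d then ρ.2.1 + 1 else ρ.2.1 - 1, q')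

/-- The starting configuration of `M` on a word. -/
def startConfig (M : NTM) (w : List ℕ) : Config := (w ++ [NTM.blank M], 0, 0)

/-- Words are over the input alphabet `{0, 1}`. -/
def IsWord (w : List ℕ) : Prop := ∀ a ∈ w, a < 2

/-- There is a run of `M` starting in `ρ` that visits the state `qr` infinitely often.
(Such a run is necessarily infinite, and every infinite sequence of `Next_M`-successive
configurations is a run; finite runs trivially feature `qr` only finitely many times.) -/
def RecurringFrom (M : NTM) (qr : ℕ) (ρ : Config) : Prop :=
  ∃ c : ℕ → Config, c 0 = ρ ∧ (∀ i, NTM.Next M (c i) (c (i + 1))) ∧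
    ∀ N : ℕ, ∃ i : ℕ, N ≤ i ∧ (c i).2.2 = qr

/-- `M` is non-recurring through `qr` on the configuration `ρ`: every run of `M` on `ρ`
features `qr` only finitely many times. -/
def NonRecurringFrom (M : NTM) (qr : ℕ) (ρ : Config) : Prop := ¬ RecurringFrom M qr ρ

end ChaseTermination
namespace ChaseTermination

/-! ### The rule set `Σ_M` of Section 4 and the databases `D_ρ` -/

/-- Predicate codes. `pF`, `pR` are the ternary time/tape successor predicates. -/
def pF : ℕ := 0
def pR : ℕ := 1
def pCL : ℕ := 2
def pCR : ℕ := 3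
def pReal : ℕ := 4
def pBrake : ℕ := 5
def pNextBr : ℕ := 6
def pEnd : ℕ := 7
/-- The binary letter predicate for the tape symbol `a`. -/
def pLetter (a : ℕ) : ℕ := 8 + 2 * a
/-- The binary state predicate for the state `q`. -/
def pState (q : ℕ) : ℕ := 9 + 2 * q

/-- Variable codes used in the rules: `x, y, x', y', w, w'` are `0, …, 5`. -/
def tv (v : ℕ) : RTerm := Sum.inl v

def A1 (p : ℕ) (s : RTerm) : Atom := (p, [s])
def A2 (p : ℕ) (s t : RTerm) : Atom := (p, [s, t])
def A3 (p : ℕ) (s t u : RTerm) : Atom := (p, [s, t, u])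

/-- `brSet(x, w)` as atoms: `{F(x,w,w), R(x,w,w), Real(x), Brake(w)}`. -/
def brSetA (x w : RTerm) : List Atom := [A3 pF x w w, A3 pR x w w, A1 pReal x, A1 pBrake w]

/-- Tape alphabet including the blank: `Γ ∪ {B}`. -/
def letters (M : NTM) : List ℕ := List.range (NTM.blank M + 1)
def states (M : NTM) : List ℕ := List.range (NTM.numStates M)

/-- The rule `R_Brake`. -/
def ruleBrake (M : NTM) : Rule :=
  ([A1 pBrake (tv 4)],
    ((letters M).map fun a => A2 (pLetter a) (tv 4) (tv 4)) ++
    ((states M).map fun q => A2 (pState q) (tv 4) (tv 4)) ++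
    [A3 pF (tv 4) (tv 4) (tv 4), A3 pR (tv 4) (tv 4) (tv 4),
     A2 pCL (tv 4) (tv 4), A2 pCR (tv 4) (tv 4), A1 pReal (tv 4), A2 pNextBr (tv 4) (tv 4)])

/-- The rule `R_nextBr`. -/
def ruleNextBr : Rule :=
  (brSetA (tv 0) (tv 4) ++ [A2 pNextBr (tv 4) (tv 5)], brSetA (tv 0) (tv 5))

/-- Transition rule for `(q', b, →) ∈ δ(q, a)` and the letter `c`; if `q = qr` a fresh
brake `w'` is created together with a `nextBr`-atom, otherwise the brake `w` is reused. -/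
def mkTransRight (qr q a q' b c : ℕ) : Rule :=
  ([A2 (pState q) (tv 0) (tv 4), A2 (pLetter a) (tv 0) (tv 4), A3 pR (tv 0) (tv 1) (tv 4),
    A2 (pLetter c) (tv 1) (tv 4)] ++ brSetA (tv 0) (tv 4) ++ brSetA (tv 1) (tv 4),
   if q = qr then
     [A2 (pState q') (tv 3) (tv 5), A2 (pLetter c) (tv 3) (tv 5), A2 (pLetter b) (tv 2) (tv 5),
      A3 pR (tv 2) (tv 3) (tv 5), A3 pF (tv 0) (tv 2) (tv 5), A3 pF (tv 1) (tv 3) (tv 5),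
      A2 pCL (tv 2) (tv 5), A2 pCR (tv 3) (tv 5)] ++
      brSetA (tv 2) (tv 5) ++ brSetA (tv 3) (tv 5) ++ [A2 pNextBr (tv 4) (tv 5)]
   else
     [A2 (pState q') (tv 3) (tv 4), A2 (pLetter c) (tv 3) (tv 4), A2 (pLetter b) (tv 2) (tv 4),
      A3 pR (tv 2) (tv 3) (tv 4), A3 pF (tv 0) (tv 2) (tv 4), A3 pF (tv 1) (tv 3) (tv 4),
      A2 pCL (tv 2) (tv 4), A2 pCR (tv 3) (tv 4)] ++ brSetA (tv 2) (tv 4) ++ brSetA (tv 3) (tv 4))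

/-- Transition rule for `(q', b, ←) ∈ δ(q, a)` and the letter `c`. -/
def mkTransLeft (qr q a q' b c : ℕ) : Rule :=
  ([A2 (pState q) (tv 0) (tv 4), A2 (pLetter a) (tv 0) (tv 4), A3 pR (tv 1) (tv 0) (tv 4),
    A2 (pLetter c) (tv 1) (tv 4)] ++ brSetA (tv 0) (tv 4) ++ brSetA (tv 1) (tv 4),
   if q = qr then
     [A2 (pState q') (tv 3) (tv 5), A2 (pLetter c) (tv 3) (tv 5), A2 (pLetter b) (tv 2) (tv 5),
      A3 pR (tv 3) (tv 2) (tv 5), A3 pF (tv 0) (tv 2) (tv 5), A3 pF (tv 1) (tv 3) (tv 5),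
      A2 pCL (tv 3) (tv 5), A2 pCR (tv 2) (tv 5)] ++
      brSetA (tv 2) (tv 5) ++ brSetA (tv 3) (tv 5) ++ [A2 pNextBr (tv 4) (tv 5)]
   else
     [A2 (pState q') (tv 3) (tv 4), A2 (pLetter c) (tv 3) (tv 4), A2 (pLetter b) (tv 2) (tv 4),
      A3 pR (tv 3) (tv 2) (tv 4), A3 pF (tv 0) (tv 2) (tv 4), A3 pF (tv 1) (tv 3) (tv 4),
      A2 pCL (tv 3) (tv 4), A2 pCR (tv 2) (tv 4)] ++ brSetA (tv 2) (tv 4) ++ brSetA (tv 3) (tv 4))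

/-- All transition rules of `Σ_M` (one per table entry and letter `c`). -/
def transRules (M : NTM) (qr : ℕ) : List Rule :=
  (NTM.table M).foldr (fun e acc =>
    ((letters M).map fun cc =>
      if e.2.2.2 = true then mkTransRight qr e.1.1 e.1.2 e.2.1 e.2.2.1 cc
      else mkTransLeft qr e.1.1 e.1.2 e.2.1 e.2.2.1 cc) ++ acc) []

/-- The rule `R_{C_R}` for the letter `a`. -/
def mkCopyRight (a : ℕ) : Rule :=
  ([A2 pCR (tv 2) (tv 5), A3 pF (tv 0) (tv 2) (tv 5), A3 pR (tv 0) (tv 1) (tv 4),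
    A2 (pLetter a) (tv 1) (tv 4)] ++
    brSetA (tv 0) (tv 4) ++ brSetA (tv 2) (tv 5) ++ brSetA (tv 1) (tv 4),
   [A3 pF (tv 1) (tv 3) (tv 5), A3 pR (tv 2) (tv 3) (tv 5), A2 (pLetter a) (tv 3) (tv 5),
    A2 pCR (tv 3) (tv 5)] ++ brSetA (tv 3) (tv 5))

/-- The rule `R_{C_L}` for the letter `a`. -/
def mkCopyLeft (a : ℕ) : Rule :=
  ([A2 pCL (tv 2) (tv 5), A3 pF (tv 0) (tv 2) (tv 5), A3 pR (tv 1) (tv 0) (tv 4),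
    A2 (pLetter a) (tv 1) (tv 4)] ++
    brSetA (tv 0) (tv 4) ++ brSetA (tv 2) (tv 5) ++ brSetA (tv 1) (tv 4),
   [A3 pF (tv 1) (tv 3) (tv 5), A3 pR (tv 3) (tv 2) (tv 5), A2 (pLetter a) (tv 3) (tv 5),
    A2 pCL (tv 3) (tv 5)] ++ brSetA (tv 3) (tv 5))

def copyRightRules (M : NTM) : List Rule := (letters M).map mkCopyRight
def copyLeftRules (M : NTM) : List Rule := (letters M).map mkCopyLeft

/-- The tape-extension rule `R_End`. -/
def ruleEnd (M : NTM) : Rule :=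
  ([A2 pCR (tv 2) (tv 5), A3 pF (tv 0) (tv 2) (tv 5), A2 pEnd (tv 0) (tv 4)] ++
    brSetA (tv 0) (tv 4) ++ brSetA (tv 2) (tv 5),
   [A3 pR (tv 2) (tv 3) (tv 5), A2 (pLetter (NTM.blank M)) (tv 3) (tv 5),
    A2 pEnd (tv 3) (tv 5)] ++ brSetA (tv 3) (tv 5))

/-- The rule set `Σ_M` of Section 4 (simulating `M`, with the designated state `qr`). -/
def SigmaM (M : NTM) (qr : ℕ) : RuleSet :=
  [ruleBrake M, ruleNextBr] ++ transRules M qr ++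
    copyLeftRules M ++ copyRightRules M ++ [ruleEnd M]

/-- The constant `c_i` (0-based). -/
def cst (i : ℕ) : GroundTerm := Sum.inl (i + 1)
/-- The brake constant `w₁` of the database. -/
def w1 : GroundTerm := Sum.inl 0

/-- `brSet(x, w)` as facts. -/
def brSetF (x w : GroundTerm) : List Fact :=
  [(pF, [x, w, w]), (pR, [x, w, w]), (pReal, [x]), (pBrake, [w])]

/-- The database `D_ρ` encoding a configuration `ρ`. -/
def Drho (M : NTM) (ρ : Config) : Database :=
  ((List.range ρ.1.length).map fun i => ((pR, [cst i, cst (i + 1), w1]) : Fact)) ++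
  ((List.range ρ.1.length).map fun i => ((pLetter (ρ.1.getD i 0), [cst i, w1]) : Fact)) ++
  [((pState ρ.2.2, [cst ρ.2.1, w1]) : Fact),
   ((pLetter (NTM.blank M), [cst ρ.1.length, w1]) : Fact),
   ((pEnd, [cst ρ.1.length, w1]) : Fact)] ++
  (List.range (ρ.1.length + 1)).foldr (fun i acc => brSetF (cst i) w1 ++ acc) []

/-! ### Wild frontiers -/

/-- The atoms explicitly required by the wild-frontier condition ("other" atoms are those
not in this set). -/
def wfListed (M : NTM) (ρ : Config) (w : GroundTerm) (x : ℕ → GroundTerm) : Set Fact :=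
  {f | (∃ i < ρ.1.length,
          f = ((pR, [x i, x (i + 1), w]) : Fact) ∨
          f = ((pLetter (ρ.1.getD i 0), [x i, w]) : Fact)) ∨
    f = ((pState ρ.2.2, [x ρ.2.1, w]) : Fact) ∨
    f = ((pEnd, [x ρ.1.length, w]) : Fact) ∨
    f = ((pLetter (NTM.blank M), [x ρ.1.length, w]) : Fact) ∨
    (∃ i ≤ ρ.1.length, f ∈ brSetF (x i) w)}

/-- `F` has a wild frontier of the configuration `ρ` overseen by `w` (Definition 4.4). -/
def WildFrontier (M : NTM) (F : Set Fact) (ρ : Config) (w : GroundTerm) : Prop :=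
  ∃ x : ℕ → GroundTerm,
    ((pReal, [w]) : Fact) ∉ F ∧
    (∀ i < ρ.1.length, ((pR, [x i, x (i + 1), w]) : Fact) ∈ F ∧
      ((pLetter (ρ.1.getD i 0), [x i, w]) : Fact) ∈ F) ∧
    ((pState ρ.2.2, [x ρ.2.1, w]) : Fact) ∈ F ∧
    ((pEnd, [x ρ.1.length, w]) : Fact) ∈ F ∧
    ((pLetter (NTM.blank M), [x ρ.1.length, w]) : Fact) ∈ F ∧
    (∀ i ≤ ρ.1.length, ∀ f ∈ brSetF (x i) w, f ∈ F) ∧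
    (∀ f ∈ F, f ∉ wfListed M ρ w x →
      ∀ i ≤ ρ.1.length, f.2.head? = some (x i) → f.2[1]? = some w)

/-! ### State atoms, generation, bow ties -/

/-- `g` is a brake of `F`. -/
def isBrake (F : Set Fact) (g : GroundTerm) : Prop := ((pBrake, [g]) : Fact) ∈ F

/-- A state atom of `F`: an atom `q(x, w)` with `q` a state of `M` and `x` not a brake. -/
def StateAtom (M : NTM) (F : Set Fact) (f : Fact) : Prop :=
  ∃ q : ℕ, q < NTM.numStates M ∧ ∃ x wb : GroundTerm,
    f = ((pState q, [x, wb]) : Fact) ∧ f ∈ F ∧ ¬ isBrake F x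

/-- `A` precedes `A'` in the derivation `c`: some applied trigger has `A` in its support
and `A'` in its output. -/
def precedes {S : RuleSet} {D : Set Fact} (c : Chase S D) (A A' : Fact) : Prop :=
  ∃ i : ℕ, (i : ℕ∞) < c.len ∧ A ∈ support (c.trig i) ∧ A' ∈ outputOf (c.trig i) (c.ext i)

/-- The fact `f` is generated (newly produced) at step `i` of the derivation `c`. -/
def generatedAt {S : RuleSet} {D : Set Fact} (c : Chase S D) (i : ℕ) (f : Fact) : Prop :=
  (i : ℕ∞) < c.len ∧ f ∈ outputOf (c.trig i) (c.ext i) ∧ f ∉ c.fact i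

/-- The fact `f` is generated by (an application of) one of the rules in `Rs`. -/
def generatedBy {S : RuleSet} {D : Set Fact} (c : Chase S D) (Rs : List Rule) (f : Fact) : Prop :=
  ∃ i : ℕ, generatedAt c i f ∧ (c.trig i).1 ∈ Rs

/-- Semantically meaningful terms: all terms of `F` except the brakes. -/
def semterms (F : Set Fact) : Set GroundTerm := {g | g ∈ termsOf F ∧ ¬ isBrake F g}

/-- The edge relation `E_R`: `(x, y) ∈ E_R` iff `R(x, y, w) ∈ F` for some `w`. -/
def ER (F : Set Fact) (u v : GroundTerm) : Prop := ∃ w, ((pR, [u, v, w]) : Fact) ∈ F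

/-- The weakly connected component of `x` in the graph induced by `E` on the vertex set `V`. -/
def wcc {α : Type} (V : Set α) (E : α → α → Prop) (x : α) : Set α :=
  {z | z ∈ V ∧ Relation.ReflTransGen (fun u v => u ∈ V ∧ v ∈ V ∧ (E u v ∨ E v u)) x z}

/-- Directed tree rooted in `r` on the vertex set `V` with edge relation `E`. -/
def IsDirTree {α : Type} (V : Set α) (E : α → α → Prop) (r : α) : Prop :=
  r ∈ V ∧
  (∀ v ∈ V, Relation.ReflTransGen (fun u v' => u ∈ V ∧ v' ∈ V ∧ E u v') r v) ∧
  (∀ v ∈ V, v ≠ r → ∃! u, u ∈ V ∧ E u v) ∧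
  (∀ u ∈ V, ¬ E u r)

/-- A bow tie with center `(x, y)` (Definition 6.2): `V_x^{-y}` induces a directed tree on the
inverse edges rooted in `x`, `V_y^{-x}` induces a directed tree rooted in `y`, and the two
components partition `V`. -/
def IsBowTie {α : Type} (V : Set α) (E : α → α → Prop) (x y : α) : Prop :=
  x ∈ V ∧ y ∈ V ∧ E x y ∧
  IsDirTree (wcc (V \ {y}) E x) (fun u v => E v u) x ∧
  IsDirTree (wcc (V \ {x}) E y) E y ∧
  wcc (V \ {y}) E x ∩ wcc (V \ {x}) E y = ∅ ∧
  wcc (V \ {y}) E x ∪ wcc (V \ {x}) E y = V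

/-- `bowtie(A)` for a state atom `q(x, w)`: the weakly connected component of `x` in
`(semterms F, E_R)`. -/
def bowtieOf (F : Set Fact) (x : GroundTerm) : Set GroundTerm := wcc (semterms F) (ER F) x

/-- A maximal `E`-path in the vertex set `V`. -/
def IsMaxPath {α : Type} (V : Set α) (E : α → α → Prop) (l : List α) : Prop :=
  l ≠ [] ∧ (∀ z ∈ l, z ∈ V) ∧ List.Chain' E l ∧
  (∀ z ∈ V, ∀ a, l.head? = some a → ¬ E z a) ∧
  (∀ z ∈ V, ∀ a, l.getLast? = some a → ¬ E a z)

/-- `configs(A)` (Definition 6.4): one candidate configuration per maximal path of `bowtie(A)`. -/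
def configsOf (M : NTM) (F : Set Fact) (A : Fact) : Set (Set Fact) :=
  {S | ∃ q : ℕ, ∃ x w : GroundTerm, A = ((pState q, [x, w]) : Fact) ∧
    ∃ l : List GroundTerm, IsMaxPath (bowtieOf F x) (ER F) l ∧
      S = insert A
        ({f | ∃ z ∈ l, f ∈ brSetF z w} ∪
         {f | f ∈ F ∧ (f.1 = pR ∨ f.1 = pEnd ∨ ∃ a ∈ letters M, f.1 = pLetter a) ∧
           f.2 ≠ [] ∧ f.2.getLast? = some w ∧ ∀ z ∈ f.2.dropLast, z ∈ l})}

/-- Homomorphic embedding of fact sets: a map on nulls (fixing all constants) sending `S`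
into `T`. -/
def mapG (h : ℕ → GroundTerm) : GroundTerm → GroundTerm
  | Sum.inl cc => Sum.inl cc
  | Sum.inr n => h n

def mapFact (h : ℕ → GroundTerm) (f : Fact) : Fact := (f.1, f.2.map (mapG h))

def HomEmbeds (S T : Set Fact) : Prop := ∃ h : ℕ → GroundTerm, ∀ f ∈ S, mapFact h f ∈ T

end ChaseTermination
namespace ChaseTermination

/-! ### The machine `M_Σ` (Definition 4.1), modelled by its canonical runs

A run of `M_Σ` on the encoding of a database corresponds exactly to a restricted chase
derivation of `⟨Σ, D⟩` (step 4 of the procedure) together with the counter `j`; the machine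
visits its designated state `q_r` once each time `j` is incremented (step 5), so a run visits
`q_r` infinitely often iff the derivation is infinite and `jseq` is unbounded. -/

open scoped Classical in
/-- The value of the counter `j` of `M_Σ` after `i` iterations of its main loop, when its
non-deterministic choices build the chase derivation `c`. -/
noncomputable def jseq {S : RuleSet} {D : Set Fact} (c : Chase S D) : ℕ → ℕ
  | 0 => 0
  | i + 1 =>
      if ∀ t : Trigger, Active S (c.fact (jseq c i)) t → obsolete t (c.fact i) then
        jseq c i + 1
      else jseq c i

/-! ### Oblivious and core chase variants -/

/-- A (possibly infinite) oblivious chase derivation: triggers need only be loaded, but no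
trigger (instance) is ever applied twice. -/
structure OblChase (S : RuleSet) (D : Set Fact) where
  len : ℕ∞
  fact : ℕ → Set Fact
  trig : ℕ → Trigger
  ext : ℕ → ℕ → GroundTerm
  init : fact 0 = D
  memAt : ∀ i : ℕ, (i : ℕ∞) < len → (trig i).1 ∈ S
  loadAt : ∀ i : ℕ, (i : ℕ∞) < len → loaded (trig i) (fact i)
  noRepeat : ∀ i j : ℕ, (i : ℕ∞) < len → (j : ℕ∞) < len →
    instOf (trig i) = instOf (trig j) → i = j
  extOk : ∀ i : ℕ, (i : ℕ∞) < len → properExt (trig i) (fact i) (ext i)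
  succ : ∀ i : ℕ, (i : ℕ∞) < len → fact (i + 1) = fact i ∪ outputOf (trig i) (ext i)
  stall : ∀ i : ℕ, ¬ ((i : ℕ∞) < len) → fact (i + 1) = fact i

/-- Fairness for the oblivious chase: every trigger that becomes loaded is eventually applied. -/
def OblFair {S : RuleSet} {D : Set Fact} (c : OblChase S D) : Prop :=
  ∀ t : Trigger, t.1 ∈ S → ∀ i : ℕ, loaded t (c.fact i) →
    ∃ j : ℕ, (j : ℕ∞) < c.len ∧ instOf (c.trig j) = instOf t

/-- `H` is a retract of `G`: `H ⊆ G` and some homomorphism (fixing constants) maps `G` into `H`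
leaving `H` pointwise fixed. -/
def RetractOf (G H : Set Fact) : Prop :=
  H ⊆ G ∧ ∃ h : ℕ → GroundTerm, (∀ f ∈ G, mapFact h f ∈ H) ∧ ∀ f ∈ H, mapFact h f = f

/-- `H` is a core of `G`: a retract of `G` without proper retracts. -/
def IsCoreOf (H G : Set Fact) : Prop := RetractOf G H ∧ ∀ H', RetractOf H H' → H' = H

/-- `G` is obtained from `F` by applying all active triggers in parallel, each with fresh
pairwise distinct nulls (distinct trigger instances use disjoint fresh nulls). -/
def IsParallelStep (S : RuleSet) (F G : Set Fact) : Prop :=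
  ∃ pe : Trigger → (ℕ → GroundTerm),
    (∀ t : Trigger, Active S F t → properExt t F (pe t)) ∧
    (∀ t t' : Trigger, Active S F t → Active S F t' → instOf t = instOf t' →
      outputOf t (pe t) = outputOf t' (pe t')) ∧
    (∀ t t' : Trigger, Active S F t → Active S F t' → instOf t ≠ instOf t' →
      ∀ n : ℕ, (Sum.inr n : GroundTerm) ∉ termsOf F →
        (Sum.inr n : GroundTerm) ∈ termsOf (outputOf t (pe t)) →
        (Sum.inr n : GroundTerm) ∉ termsOf (outputOf t' (pe t'))) ∧
    G = F ∪ ⋃ t ∈ {t : Trigger | Active S F t}, outputOf t (pe t)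

/-- A (possibly infinite) core chase sequence: `F_{i+1}` is a core of the parallel application
of all active triggers to `F_i`, and the sequence stops exactly when this is a fixpoint. -/
structure CoreChase (S : RuleSet) (D : Set Fact) where
  len : ℕ∞
  fact : ℕ → Set Fact
  init : fact 0 = D
  step : ∀ i : ℕ, (i : ℕ∞) < len →
    ∃ G, IsParallelStep S (fact i) G ∧ IsCoreOf (fact (i + 1)) G ∧ fact (i + 1) ≠ fact i
  halt : ∀ i : ℕ, ¬ ((i : ℕ∞) < len) → ∃ G, IsParallelStep S (fact i) G ∧ IsCoreOf (fact i) G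
  stall : ∀ i : ℕ, ¬ ((i : ℕ∞) < len) → fact (i + 1) = fact i

/-- The three chase variants. -/
inductive Variant : Type | obl | rest | core

/-- `qExists` ("sometimes") and `qForall` ("always") termination. -/
inductive Quant : Type | qExists | qForall

/-- `Terminates v q S D`: the knowledge base `⟨S, D⟩` `q`-terminates for the chase variant `v`
(`qExists`: some chase sequence is finite; `qForall`: all chase sequences are finite). -/
def Terminates (v : Variant) (q : Quant) (S : RuleSet) (D : Set Fact) : Prop :=
  match v, q with
  | .rest, .qExists => ∃ c : Chase S D, Fair c ∧ c.len ≠ ⊤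
  | .rest, .qForall => ∀ c : Chase S D, Fair c → c.len ≠ ⊤
  | .obl, .qExists => ∃ c : OblChase S D, OblFair c ∧ c.len ≠ ⊤
  | .obl, .qForall => ∀ c : OblChase S D, OblFair c → c.len ≠ ⊤
  | .core, .qExists => ∃ c : CoreChase S D, c.len ≠ ⊤
  | .core, .qForall => ∀ c : CoreChase S D, c.len ≠ ⊤

end ChaseTermination

namespace Language

open scoped Computability

variable {α : Type*} {L M : Language α}

/-- The words that consist of a single letter from `s`. -/
def singletons (s : Set α) : Language α := {w | ∃ a ∈ s, [a] = w}

theorem isRegular_singletons (s : Set α) : (singletons s).IsRegular := by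
  refine .of_finite_range_leftQuotient (Set.Finite.subset
    (((Set.finite_singleton 0).insert 1).insert (singletons s)) ?_)
  rintro _ ⟨x, rfl⟩
  match x with
  | [] => exact Or.inl rfl
  | [a] =>
    by_cases ha : a ∈ s
    · refine Or.inr (Or.inl (ext fun y => ?_))
      rw [mem_leftQuotient, mem_one]
      constructor
      · rintro ⟨b, -, h⟩
        exact (by simpa using h : b = a ∧ y = []).2
      · rintro rfl
        exact ⟨a, ha, rfl⟩
    · refine Or.inr (Or.inr (ext fun y => ?_))
      rw [mem_leftQuotient]
      refine iff_of_false ?_ (notMem_zero _)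
      rintro ⟨b, hb, h⟩
      simp only [List.cons_append, List.nil_append, List.cons.injEq] at h
      exact ha (h.1 ▸ hb)
  | a :: b :: x =>
    refine Or.inr (Or.inr (ext fun y => ?_))
    rw [mem_leftQuotient]
    refine iff_of_false ?_ (notMem_zero _)
    rintro ⟨b, -, h⟩
    simp at h

protected theorem IsRegular.mul (hL : L.IsRegular) (hM : M.IsRegular) : (L * M).IsRegular := by
  refine .of_finite_range_leftQuotient (((hL.finite_range_leftQuotient.prod
    hM.finite_range_leftQuotient.powerset).image
    fun p : Language α × Set (Language α) => p.1 * M + ⨆ B : p.2, (B : Language α)).subset ?_)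
  rintro _ ⟨x, rfl⟩
  refine ⟨(L.leftQuotient x, {B | ∃ u t, x = u ++ t ∧ u ∈ L ∧ B = M.leftQuotient t}),
    ⟨⟨x, rfl⟩, ?_⟩, ext fun z => ?_⟩
  · rintro _ ⟨u, t, -, -, rfl⟩
    exact ⟨t, rfl⟩
  · simp only [mem_add, mem_iSup, mem_leftQuotient, mem_mul, Subtype.exists, Set.mem_ofPred_eq]
    constructor
    · rintro (⟨t, ht, v, hv, rfl⟩ | ⟨_, ⟨u, t, rfl, hu, rfl⟩, hz⟩)
      · exact ⟨x ++ t, ht, v, hv, by simp⟩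
      · exact ⟨u, hu, t ++ z, hz, by simp⟩
    · rintro ⟨u, hu, v, hv, h⟩
      rcases List.append_eq_append_iff.1 h with ⟨t, rfl, rfl⟩ | ⟨t, rfl, rfl⟩
      · exact Or.inr ⟨_, ⟨u, t, rfl, hu, rfl⟩, hv⟩
      · exact Or.inl ⟨t, hu, v, hv, rfl⟩

theorem append_mem_kstar_iff {x z : List α} (hx : x ≠ []) :
    x ++ z ∈ L∗ ↔ ∃ u t, x = u ++ t ∧ u ∈ L∗ ∧ z ∈ L.leftQuotient t * L∗ := by
  constructor
  · rintro ⟨ys, h, hys⟩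
    induction ys generalizing x with
    | nil => simp_all
    | cons y ys ih =>
      have hy := hys y (by simp)
      have hys' : ∀ y ∈ ys, y ∈ L := fun y' hy' => hys y' (by simp [hy'])
      rw [List.flatten_cons] at h
      rcases List.append_eq_append_iff.1 h with ⟨t, rfl, rfl⟩ | ⟨t, rfl, h'⟩
      · exact ⟨[], x, rfl, nil_mem_kstar _, t, hy, _, join_mem_kstar hys', rfl⟩
      · rcases eq_or_ne t [] with rfl | ht
        · refine ⟨[], y, by simp, nil_mem_kstar _, [],
            (mem_leftQuotient ..).2 (by simpa using hy), z, ?_, rfl⟩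
          rw [List.nil_append] at h'
          rw [← h']
          exact join_mem_kstar hys'
        · obtain ⟨u, t', rfl, ⟨us, rfl, hus⟩, hz⟩ := ih ht h'.symm hys'
          refine ⟨y ++ us.flatten, t', by simp, ⟨y :: us, rfl, ?_⟩, hz⟩
          simpa [hy] using hus
  · rintro ⟨u, t, rfl, ⟨us, rfl, hus⟩, v, hv, _, ⟨ws, rfl, hws⟩, rfl⟩
    refine ⟨us ++ (t ++ v) :: ws, by simp, ?_⟩
    simp only [List.mem_append, List.mem_cons]
    rintro y (hy | rfl | hy)
    · exact hus y hy
    · exact hv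
    · exact hws y hy

protected theorem IsRegular.kstar (hL : L.IsRegular) : (L∗).IsRegular := by
  refine .of_finite_range_leftQuotient (((hL.finite_range_leftQuotient.powerset.image
    fun S : Set (Language α) => ⨆ B : S, (B : Language α) * L∗).insert (L∗)).subset ?_)
  rintro _ ⟨x, rfl⟩
  rcases eq_or_ne x [] with rfl | hx
  · exact Or.inl rfl
  refine Or.inr ⟨{B | ∃ u t, x = u ++ t ∧ u ∈ L∗ ∧ B = L.leftQuotient t}, ?_, ext fun z => ?_⟩
  · rintro _ ⟨u, t, -, -, rfl⟩
    exact ⟨t, rfl⟩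
  · rw [mem_leftQuotient, append_mem_kstar_iff hx]
    simp only [mem_iSup, Subtype.exists, Set.mem_ofPred_eq]
    constructor
    · rintro ⟨_, ⟨u, t, hx, hu, rfl⟩, hz⟩
      exact ⟨u, t, hx, hu, hz⟩
    · rintro ⟨u, t, hx, hu, hz⟩
      exact ⟨_, ⟨u, t, hx, hu, rfl⟩, hz⟩

end Language

namespace ChaseTermination

open Function
open scoped Computability

/-- Non-deterministic programs over registers that hold natural numbers. -/
inductive Prog : Type
  | inc (x : ℕ)
  | dec (x : ℕ)
  | zero (x : ℕ)
  | eq (x y : ℕ)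
  | seq (p q : Prog)
  | star (p : Prog)

namespace Prog

/-- The input-output relation of a program on register contents. -/
def Run : Prog → (ℕ → ℕ) → (ℕ → ℕ) → Prop
  | inc x, σ, τ => τ = update σ x (σ x + 1)
  | dec x, σ, τ => ∃ n, σ x = n + 1 ∧ τ = update σ x n
  | zero x, σ, τ => σ x = 0 ∧ τ = σ
  | eq x y, σ, τ => σ x = σ y ∧ τ = σ
  | seq p q, σ, τ => ∃ ρ, p.Run σ ρ ∧ q.Run ρ τ
  | star p, σ, τ => Relation.ReflTransGen p.Run σ τ

/-- A strict upper bound on the registers used by a program. -/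
def width : Prog → ℕ
  | inc x | dec x | zero x => x + 1
  | eq x y => max x y + 1
  | seq p q => max p.width q.width
  | star p => p.width

/-- Reset a register. -/
def clear (x : ℕ) : Prog := seq (star (dec x)) (zero x)

/-- Store an arbitrary number in a register. -/
def havoc (x : ℕ) : Prog := seq (clear x) (star (inc x))

theorem run_star_dec {x : ℕ} {σ τ : ℕ → ℕ} :
    (star (dec x)).Run σ τ ↔ ∃ m ≤ σ x, τ = update σ x m := by
  constructor
  · intro h
    induction h with
    | refl => exact ⟨σ x, le_rfl, by simp⟩
    | tail _ h ih =>
      obtain ⟨m, hm, rfl⟩ := ih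
      obtain ⟨n, hn, rfl⟩ := h
      simp only [update_self] at hn
      exact ⟨n, by omega, by simp⟩
  · rintro ⟨m, hm, rfl⟩
    obtain ⟨d, hd⟩ := Nat.exists_eq_add_of_le hm
    induction d generalizing m with
    | zero =>
      have : update σ x m = σ := by rw [← Nat.add_zero m, ← hd]; simp
      rw [this]; exact .refl
    | succ d ih => exact .tail (ih (m + 1) (by omega) (by omega)) ⟨m, by simp, by simp⟩

theorem run_clear {x : ℕ} {σ τ : ℕ → ℕ} : (clear x).Run σ τ ↔ τ = update σ x 0 := by
  constructor
  · rintro ⟨ρ, h, h0, rfl⟩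
    obtain ⟨m, -, rfl⟩ := run_star_dec.1 h
    simp only [update_self] at h0
    rw [h0]
  · rintro rfl
    exact ⟨_, run_star_dec.2 ⟨0, Nat.zero_le _, rfl⟩, by simp, rfl⟩

theorem run_havoc {x : ℕ} {σ τ : ℕ → ℕ} : (havoc x).Run σ τ ↔ ∃ y, τ = update σ x y := by
  constructor
  · rintro ⟨ρ, h, h'⟩
    rw [run_clear] at h
    subst h
    change Relation.ReflTransGen _ _ _ at h'
    induction h' with
    | refl => exact ⟨0, rfl⟩
    | tail _ h ih =>
      obtain ⟨y, rfl⟩ := ih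
      exact ⟨y + 1, by rw [h]; simp⟩
  · rintro ⟨y, rfl⟩
    refine ⟨_, run_clear.2 rfl, ?_⟩
    change Relation.ReflTransGen _ _ _
    induction y with
    | zero => exact .refl
    | succ y ih => exact .tail ih (by simp [Run])

end Prog

open Prog

/-- `P` is tested by a program that may use the registers from `b` on, all of them initially
zero, as work space. -/
def Testable (b : ℕ) (P : (ℕ → ℕ) → Prop) : Prop :=
  ∃ p : Prog, ∀ σ : ℕ → ℕ, (∀ i, b ≤ i → σ i = 0) → ∀ τ, p.Run σ τ ↔ P σ ∧ τ = σ

namespace Testable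

variable {b : ℕ} {P Q : (ℕ → ℕ) → Prop}

theorem of_iff (h : Testable b P) (hPQ : ∀ σ, P σ ↔ Q σ) : Testable b Q :=
  (funext fun σ => propext (hPQ σ) : P = Q) ▸ h

protected theorem zero (b x : ℕ) : Testable b fun σ => σ x = 0 :=
  ⟨.zero x, fun _ _ _ => Iff.rfl⟩

protected theorem eq (b x y : ℕ) : Testable b fun σ => σ x = σ y :=
  ⟨.eq x y, fun _ _ _ => Iff.rfl⟩

protected theorem and (hP : Testable b P) (hQ : Testable b Q) :
    Testable b fun σ => P σ ∧ Q σ := by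
  obtain ⟨p, hp⟩ := hP
  obtain ⟨q, hq⟩ := hQ
  refine ⟨.seq p q, fun σ hσ τ => ⟨?_, ?_⟩⟩
  · rintro ⟨ρ, h, h'⟩
    obtain ⟨h, rfl⟩ := (hp _ hσ _).1 h
    obtain ⟨h', rfl⟩ := (hq _ hσ _).1 h'
    exact ⟨⟨h, h'⟩, rfl⟩
  · rintro ⟨⟨h, h'⟩, rfl⟩
    exact ⟨τ, (hp _ hσ _).2 ⟨h, rfl⟩, (hq _ hσ _).2 ⟨h', rfl⟩⟩

theorem all_fin {n : ℕ} {P : Fin n → (ℕ → ℕ) → Prop} (h : ∀ i, Testable b (P i)) :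
    Testable b fun σ => ∀ i, P i σ := by
  induction n with
  | zero => exact (Testable.eq b 0 0).of_iff fun σ => by simp
  | succ n ih =>
    exact ((h 0).and (ih fun i => h i.succ)).of_iff fun σ => by rw [Fin.forall_fin_succ]

theorem succ {x : ℕ} (hx : x < b) (hP : Testable b P) :
    Testable b fun σ => P (update σ x (σ x + 1)) := by
  obtain ⟨p, hp⟩ := hP
  have hz : ∀ σ : ℕ → ℕ, (∀ i, b ≤ i → σ i = 0) →
      ∀ i, b ≤ i → update σ x (σ x + 1) i = 0 := fun σ hσ i hi => by
    rw [update_of_ne (by omega)]; exact hσ i hi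
  refine ⟨.seq (.inc x) (.seq p (.dec x)), fun σ hσ τ => ⟨?_, ?_⟩⟩
  · rintro ⟨ρ, rfl, ρ', h', n, hn, rfl⟩
    obtain ⟨h, rfl⟩ := (hp _ (hz σ hσ) _).1 h'
    simp only [update_self, Nat.add_right_cancel_iff] at hn
    subst hn
    exact ⟨h, by simp⟩
  · rintro ⟨h, rfl⟩
    exact ⟨_, rfl, _, (hp _ (hz τ hσ) _).2 ⟨h, rfl⟩, τ x, by simp, by simp⟩

theorem exists_reg (hP : Testable (b + 1) P) :
    Testable b fun σ => ∃ y, P (update σ b y) := by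
  obtain ⟨p, hp⟩ := hP
  have hz : ∀ σ : ℕ → ℕ, (∀ i, b ≤ i → σ i = 0) →
      ∀ y i, b + 1 ≤ i → update σ b y i = 0 := fun σ hσ y i hi => by
    rw [update_of_ne (by omega)]; exact hσ i (by omega)
  have hb : ∀ σ : ℕ → ℕ, (∀ i, b ≤ i → σ i = 0) → update σ b 0 = σ := fun σ hσ => by
    rw [← hσ b le_rfl]; simp
  refine ⟨.seq (havoc b) (.seq p (clear b)), fun σ hσ τ => ⟨?_, ?_⟩⟩
  · rintro ⟨ρ, h₁, ρ', h₂, h₃⟩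
    obtain ⟨y, rfl⟩ := run_havoc.1 h₁
    obtain ⟨h, rfl⟩ := (hp _ (hz σ hσ y) _).1 h₂
    rw [run_clear.1 h₃]
    exact ⟨⟨y, h⟩, by simpa using hb σ hσ⟩
  · rintro ⟨⟨y, h⟩, rfl⟩
    exact ⟨_, run_havoc.2 ⟨y, rfl⟩, _, (hp _ (hz τ hσ y) _).2 ⟨h, rfl⟩,
      run_clear.2 (by simpa using (hb τ hσ).symm)⟩

theorem exists_block (n : ℕ) (hP : Testable (b + n) P) :
    Testable b fun σ => ∃ τ, (∀ i < b, τ i = σ i) ∧ (∀ i, b + n ≤ i → τ i = σ i) ∧ P τ := by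
  induction n generalizing P with
  | zero =>
    refine hP.of_iff fun σ => ⟨fun h => ⟨σ, by simp, by simp, h⟩, ?_⟩
    rintro ⟨τ, h₁, h₂, h⟩
    have : τ = σ := funext fun i => (lt_or_ge i b).elim (h₁ i) (h₂ i)
    exact this ▸ h
  | succ n ih =>
    have hP' : Testable (b + n + 1) P := hP
    refine (ih hP'.exists_reg).of_iff fun σ => ⟨?_, ?_⟩
    · rintro ⟨τ, h₁, h₂, y, h⟩
      refine ⟨_, fun i hi => ?_, fun i hi => ?_, h⟩
      · rw [update_of_ne (by omega)]; exact h₁ i hi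
      · rw [update_of_ne (by omega)]; exact h₂ i (by omega)
    · rintro ⟨τ, h₁, h₂, h⟩
      refine ⟨update τ (b + n) (σ (b + n)), fun i hi => ?_, fun i hi => ?_, τ (b + n), ?_⟩
      · rw [update_of_ne (by omega)]; exact h₁ i hi
      · rcases eq_or_ne i (b + n) with rfl | hne
        · simp
        · rw [update_of_ne hne]; exact h₂ i (by omega)
      · simpa using h

/-- Bounded iteration: `x` steps lead from `y` to `z`, where the step with number `σ b` from
`σ (b + 1)` to `σ (b + 2)` is tested by `P`. -/
theorem iterate {x y z : ℕ} (hx : x < b) (hy : y < b) (hz : z < b) (hP : Testable (b + 3) P) :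
    Testable b fun σ => ∃ s : ℕ → ℕ, s 0 = σ y ∧ s (σ x) = σ z ∧
      ∀ i < σ x, P (update (update (update σ b i) (b + 1) (s i)) (b + 2) (s (i + 1))) := by
  obtain ⟨p, hp⟩ := hP
  let body : Prog := .seq (havoc (b + 2)) (.seq p (.seq (havoc (b + 1))
    (.seq (.eq (b + 1) (b + 2)) (.seq (clear (b + 2)) (.inc b)))))
  let st (σ : ℕ → ℕ) (i a : ℕ) : ℕ → ℕ := update (update σ b i) (b + 1) a
  have st_lt : ∀ σ i a j, j < b → st σ i a j = σ j := fun σ i a j hj => by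
    simp only [st]; rw [update_of_ne (by omega), update_of_ne (by omega)]
  have st_b : ∀ σ i a, st σ i a b = i := fun σ i a => by
    simp only [st]; rw [update_of_ne (by omega)]; simp
  have st_b1 : ∀ σ i a, st σ i a (b + 1) = a := fun σ i a => by simp [st]
  have st_st : ∀ σ i a i' a', st (st σ i a) i' a' = st σ i' a' := fun σ i a i' a' => by
    ext j; simp only [st, update_apply]; split_ifs <;> rfl
  have hbody : ∀ σ : ℕ → ℕ, (∀ i, b ≤ i → σ i = 0) → ∀ i a τ, body.Run (st σ i a) τ ↔
      ∃ a', P (update (st σ i a) (b + 2) a') ∧ τ = st σ (i + 1) a' := by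
    intro σ hσ i a τ
    have hz' : ∀ a' j, b + 3 ≤ j → update (st σ i a) (b + 2) a' j = 0 := fun a' j hj => by
      simp only [st]
      rw [update_of_ne (by omega), update_of_ne (by omega), update_of_ne (by omega)]
      exact hσ j (by omega)
    have key : ∀ a', update (update (update (update (st σ i a) (b + 2) a') (b + 1) a') (b + 2) 0) b
        (i + 1) = st σ (i + 1) a' := fun a' => by
      ext j
      have := hσ (b + 2) (by omega)
      simp only [st, update_apply]
      split_ifs <;> first | rfl | omega | simp_all
    constructor
    · rintro ⟨ρ₁, h₁, ρ₂, h₂, ρ₃, h₃, ρ₄, ⟨h₄, rfl⟩, ρ₅, h₅, h₆⟩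
      obtain ⟨a', rfl⟩ := run_havoc.1 h₁
      obtain ⟨h, rfl⟩ := (hp _ (hz' a') _).1 h₂
      obtain ⟨a'', rfl⟩ := run_havoc.1 h₃
      rw [run_clear] at h₅
      subst h₅
      have : a'' = a' := by simpa using h₄
      subst this
      refine ⟨a'', h, ?_⟩
      rw [← key, h₆]
      congr 1
      simp [st]
    · rintro ⟨a', h, rfl⟩
      refine ⟨_, run_havoc.2 ⟨a', rfl⟩, _, (hp _ (hz' a') _).2 ⟨h, rfl⟩, _,
        run_havoc.2 ⟨a', rfl⟩, _, ⟨by simp, rfl⟩, _, run_clear.2 rfl, ?_⟩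
      rw [← key]
      simp [Run, st]
  have hstar : ∀ σ : ℕ → ℕ, (∀ i, b ≤ i → σ i = 0) → ∀ a τ, (star body).Run (st σ 0 a) τ ↔
      ∃ n, ∃ s : ℕ → ℕ, s 0 = a ∧ τ = st σ n (s n) ∧
        ∀ i < n, P (update (st σ i (s i)) (b + 2) (s (i + 1))) := by
    intro σ hσ a τ
    constructor
    · intro h
      change Relation.ReflTransGen _ _ _ at h
      induction h with
      | refl => exact ⟨0, fun _ => a, rfl, rfl, by simp⟩
      | tail _ hstep ih =>
        obtain ⟨n, s, h0, rfl, hs⟩ := ih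
        obtain ⟨a', h, rfl⟩ := (hbody σ hσ _ _ _).1 hstep
        refine ⟨n + 1, fun i => if i ≤ n then s i else a', by simpa using h0, by simp, ?_⟩
        intro i hi
        rcases Nat.lt_succ_iff_lt_or_eq.1 hi with hi | rfl
        · simpa [hi.le, Nat.succ_le_iff.2 hi] using hs i hi
        · simpa using h
    · rintro ⟨n, s, rfl, rfl, hs⟩
      change Relation.ReflTransGen _ _ _
      induction n with
      | zero => exact .refl
      | succ n ih =>
        exact .tail (ih fun i hi => hs i (by omega))
          ((hbody σ hσ _ _ _).2 ⟨_, hs n (by omega), rfl⟩)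
  refine ⟨.seq (havoc (b + 1)) (.seq (.eq (b + 1) y) (.seq (star body) (.seq (.eq b x)
    (.seq (.eq (b + 1) z) (.seq (clear b) (clear (b + 1))))))), fun σ hσ τ => ?_⟩
  have h0 : ∀ a, update σ (b + 1) a = st σ 0 a := fun a => by
    simp only [st]; rw [← hσ b le_rfl]; simp
  have hend : ∀ i a, update (update (st σ i a) b 0) (b + 1) 0 = σ := fun i a => by
    ext j
    have := hσ (b + 1) (by omega)
    have := hσ b (by omega)
    simp only [st, update_apply]
    split_ifs <;> simp_all
  constructor
  · rintro ⟨ρ₁, h₁, ρ₂, ⟨h₂, rfl⟩, ρ₃, h₃, ρ₄, ⟨h₄, rfl⟩, ρ₅, ⟨h₅, rfl⟩, ρ₆, h₆, h₇⟩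
    obtain ⟨a, rfl⟩ := run_havoc.1 h₁
    rw [h0] at h₂ h₃
    obtain ⟨n, s, hs0, rfl, hs⟩ := (hstar σ hσ a _).1 h₃
    rw [run_clear] at h₆ h₇
    subst h₆ h₇
    rw [st_b1, st_lt _ _ _ _ hy] at h₂
    rw [st_b, st_lt _ _ _ _ hx] at h₄
    rw [st_b1, st_lt _ _ _ _ hz] at h₅
    subst h₄
    exact ⟨⟨s, by omega, h₅, hs⟩, hend _ _⟩
  · rintro ⟨⟨s, hs0, hsz, hs⟩, rfl⟩
    refine ⟨_, run_havoc.2 ⟨s 0, rfl⟩, _, ⟨?_, rfl⟩, _,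
      (h0 (s 0)).symm ▸ (hstar τ hσ _ _).2 ⟨τ x, s, rfl, rfl, hs⟩, _, ⟨?_, rfl⟩, _, ⟨?_, rfl⟩, _,
      run_clear.2 rfl, run_clear.2 (hend _ _).symm⟩
    · rw [h0, st_b1, st_lt _ _ _ _ hy, hs0]
    · rw [st_b, st_lt _ _ _ _ hx]
    · rw [st_b1, st_lt _ _ _ _ hz, hsz]

end Testable

/-- The graph of `f` is testable, whatever registers hold its arguments and its value. -/
def TestableGraph {n : ℕ} (f : List.Vector ℕ n →. ℕ) : Prop :=
  ∀ (b : ℕ) (xs : Fin n → ℕ) (o : ℕ), (∀ i, xs i < b) → o < b →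
    Testable b fun σ => σ o ∈ f (List.Vector.ofFn fun i => σ (xs i))

theorem mem_mOfFn {m : ℕ} (g : Fin m → Part ℕ) (w : List.Vector ℕ m) :
    w ∈ (List.Vector.mOfFn g : Part (List.Vector ℕ m)) ↔ ∀ i, w.get i ∈ g i := by
  induction m with
  | zero => simp [List.Vector.mOfFn, pure, List.Vector.eq_nil w]
  | succ m ih =>
    simp only [List.Vector.mOfFn, bind, pure, Part.mem_bind_iff, Part.mem_some_iff, ih]
    rw [Fin.forall_fin_succ]
    constructor
    · rintro ⟨a, ha, v, hv, rfl⟩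
      simpa using ⟨ha, hv⟩
    · rintro ⟨h0, hs⟩
      refine ⟨w.head, by simpa using h0, w.tail, fun i => ?_, by simp⟩
      simpa using hs i

namespace TestableGraph

variable {m n : ℕ}

theorem comp {f : List.Vector ℕ n →. ℕ} {g : Fin n → List.Vector ℕ m →. ℕ}
    (hf : TestableGraph f) (hg : ∀ i, TestableGraph (g i)) :
    TestableGraph fun v => (List.Vector.mOfFn fun i => g i v) >>= f := by
  intro b xs o hxs ho
  refine (Testable.exists_block n ((Testable.all_fin fun i : Fin n =>
    hg i (b + n) xs (b + i) (fun j => (hxs j).trans_le (by omega)) (by omega)).and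
      (hf (b + n) (fun i => b + i) o (fun i => by omega) (by omega)))).of_iff fun σ => ?_
  have hbind : ∀ (v : Part (List.Vector ℕ n)) y, y ∈ v >>= f ↔ ∃ w ∈ v, y ∈ f w :=
    fun _ _ => Part.mem_bind_iff
  simp only [hbind, mem_mOfFn]
  constructor
  · rintro ⟨τ, h₁, h₂, h₃, h₄⟩
    refine ⟨List.Vector.ofFn fun i => τ (b + i), fun i => ?_, ?_⟩
    · simpa [h₁ _ (hxs _)] using h₃ i
    · simpa [h₁ _ ho] using h₄
  · rintro ⟨w, hw, h⟩
    refine ⟨fun i => if h : b ≤ i ∧ i < b + n then w.get ⟨i - b, by omega⟩ else σ i,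
      fun i hi => ?_, fun i hi => ?_, fun i => ?_, ?_⟩
    · exact dif_neg (by omega)
    · exact dif_neg (by omega)
    · have : ∀ j, ¬ (b ≤ xs j ∧ xs j < b + n) := fun j => by have := hxs j; omega
      simpa [this] using hw i
    · have : ¬ (b ≤ o ∧ o < b + n) := by omega
      simpa [this] using h

theorem prec {f : List.Vector ℕ n → ℕ} {g : List.Vector ℕ (n + 2) → ℕ}
    (hf : TestableGraph fun v => Part.some (f v)) (hg : TestableGraph fun v => Part.some (g v)) :
    TestableGraph fun v : List.Vector ℕ (n + 1) =>
      Part.some (v.head.rec (f v.tail) fun y ih => g (y ::ᵥ ih ::ᵥ v.tail) : ℕ) := by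
  intro b xs o hxs ho
  have h0 := hf (b + 1) (fun i => xs i.succ) b (fun i => (hxs _).trans_le (by omega)) (by omega)
  have h1 := hg (b + 4) (Fin.cons (b + 1) (Fin.cons (b + 2) fun i => xs i.succ)) (b + 3)
    (by
      simp only [Fin.forall_fin_succ, Fin.cons_zero, Fin.cons_succ]
      exact ⟨by omega, by omega, fun i => (hxs _).trans (by omega)⟩)
    (by omega)
  refine (Testable.exists_reg (h0.and (Testable.iterate (b := b + 1) (x := xs 0) (y := b) (z := o)
    ((hxs 0).trans_le (by omega)) (by omega) (by omega) h1))).of_iff fun σ => ?_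
  have hne : ∀ i, xs i ≠ b := fun i => (hxs i).ne
  have hne1 : ∀ i, xs i ≠ b + 1 := fun i => by have := hxs i; omega
  have hne2 : ∀ i, xs i ≠ b + 2 := fun i => by have := hxs i; omega
  have hne3 : ∀ i, xs i ≠ b + 3 := fun i => by have := hxs i; omega
  have ho' : o ≠ b := ho.ne
  have hvec : ∀ τ : ℕ → ℕ, (List.Vector.ofFn fun i : Fin (n + 2) => τ ((Fin.cons (b + 1)
      (Fin.cons (b + 2) fun i => xs i.succ) : Fin (n + 2) → ℕ) i)) =
      τ (b + 1) ::ᵥ τ (b + 2) ::ᵥ List.Vector.ofFn fun i => τ (xs i.succ) := fun τ => rfl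
  simp only [hvec]
  simp [hne, hne1, hne2, hne3, ho']
  set F : ℕ → ℕ := fun k => Nat.rec (f (List.Vector.ofFn fun i => σ (xs i.succ)))
    (fun y ih => g (y ::ᵥ ih ::ᵥ List.Vector.ofFn fun i => σ (xs i.succ))) k with hF
  constructor
  · rintro ⟨s, hs0, hsz, hs⟩
    rw [← hsz]
    suffices ∀ k ≤ σ (xs 0), s k = F k from this _ le_rfl
    intro k hk
    induction k with
    | zero => exact hs0
    | succ k ih => rw [hs k (by omega), ih (by omega)]
  · intro h
    exact ⟨F, rfl, h.symm, fun i _ => rfl⟩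

theorem rfind {f : List.Vector ℕ (n + 1) → ℕ} (hf : TestableGraph fun v => Part.some (f v)) :
    TestableGraph fun v => Nat.rfind fun k => Part.some (decide (f (k ::ᵥ v) = 0)) := by
  intro b xs o hxs ho
  have h0 := hf (b + 1) (Fin.cons o xs) b
    (by
      simp only [Fin.forall_fin_succ, Fin.cons_zero, Fin.cons_succ]
      exact ⟨by omega, fun i => (hxs _).trans (by omega)⟩)
    (by omega)
  have h1 := hf (b + 4) (Fin.cons b xs) (b + 3)
    (by
      simp only [Fin.forall_fin_succ, Fin.cons_zero, Fin.cons_succ]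
      exact ⟨by omega, fun i => (hxs _).trans (by omega)⟩)
    (by omega)
  have h2 := (h1.succ (x := b + 3) (by omega)).exists_reg
  refine (((Testable.zero _ b).and h0).exists_reg.and
    (Testable.iterate ho ho ho h2)).of_iff fun σ => ?_
  have hne : ∀ i, xs i ≠ b := fun i => (hxs i).ne
  have hne1 : ∀ i, xs i ≠ b + 1 := fun i => by have := hxs i; omega
  have hne2 : ∀ i, xs i ≠ b + 2 := fun i => by have := hxs i; omega
  have hne3 : ∀ i, xs i ≠ b + 3 := fun i => by have := hxs i; omega
  have ho' : o ≠ b := ho.ne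
  have hvec : ∀ (τ : ℕ → ℕ) c, (List.Vector.ofFn fun i : Fin (n + 1) =>
      τ ((Fin.cons c xs : Fin (n + 1) → ℕ) i)) =
      τ c ::ᵥ List.Vector.ofFn fun i => τ (xs i) := fun τ c => rfl
  simp only [hvec]
  have hb : ∀ (k : ℕ) (s : ℕ → ℕ), update (update σ b k) (b + 1) (s k) b = k := fun k s => by
    rw [update_of_ne (by omega), update_self]
  have hmem : ∀ v, σ o ∈ Nat.rfind (fun k => Part.some (decide (f (k ::ᵥ v) = 0))) ↔
      f (σ o ::ᵥ v) = 0 ∧ ∀ k < σ o, f (k ::ᵥ v) ≠ 0 := fun v => by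
    refine Nat.mem_rfind.trans ?_
    simp [eq_comm]
  rw [hmem]
  simp only [Part.mem_some_iff, update_self, ne_eq, hne, hne1, hne2, hne3, ho',
    not_false_eq_true, update_of_ne, exists_eq_left, Nat.left_eq_add, OfNat.ofNat_ne_zero, hb]
  refine and_congr eq_comm ⟨?_, fun h => ⟨fun _ => σ o, rfl, rfl, fun i hi => ?_⟩⟩
  · rintro ⟨s, -, -, hs⟩ k hk h
    obtain ⟨y, hy⟩ := hs k hk
    omega
  · exact ⟨f (i ::ᵥ List.Vector.ofFn fun i => σ (xs i)) - 1, by have := h i hi; omega⟩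

theorem zero : TestableGraph fun _ : List.Vector ℕ 0 => Part.some 0 := fun b _ o _ _ =>
  (Testable.zero b o).of_iff fun _ => Part.mem_some_iff.symm

theorem get (i : Fin n) : TestableGraph fun v => Part.some (v.get i) := fun b xs o _ _ =>
  (Testable.eq b o (xs i)).of_iff fun σ => by simp

theorem succ : TestableGraph fun v : List.Vector ℕ 1 => Part.some v.head.succ := by
  intro b xs o hxs ho
  refine (Testable.exists_reg ((Testable.eq (b + 1) b (xs 0)).and
    ((Testable.eq (b + 1) b o).succ (x := b) (by omega)))).of_iff fun σ => ?_
  have := (hxs 0).ne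
  simp [this, ho.ne, eq_comm]

theorem of_primrec' {f : List.Vector ℕ n → ℕ} (hf : Nat.Primrec' f) :
    TestableGraph fun v => Part.some (f v) := by
  induction hf with
  | zero => exact zero
  | succ => exact succ
  | get i => exact get i
  | comp g _ _ hf hg =>
    have := hf.comp hg
    simpa only [Vector.mOfFn_part_some, bind, Part.bind_some] using this
  | prec _ _ hf hg => exact hf.prec hg

theorem of_partrec' {f : List.Vector ℕ n →. ℕ} (hf : Nat.Partrec' f) : TestableGraph f := by
  induction hf with
  | prim hf => exact of_primrec' hf
  | comp g _ _ hf hg => exact hf.comp hg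
  | rfind _ hf => exact hf.rfind

end TestableGraph

/-- The register contents `a, c, 0, 0, …`. -/
def pairRegs (a c : ℕ) : ℕ → ℕ := update (update (fun _ => 0) 0 a) 1 c

theorem pairRegs_injective (a : ℕ) : Injective (pairRegs a) := fun c c' h => by
  simpa [pairRegs] using congrFun h 1

theorem testable_three {S : ℕ → ℕ → ℕ → Bool}
    (hS : Computable fun x : ℕ × ℕ × ℕ => S x.1 x.2.1 x.2.2) :
    Testable 3 fun σ => S (σ 0) (σ 1) (σ 2) = true := by
  let F : List.Vector ℕ 3 → ℕ := fun v => cond (S (v.get 0) (v.get 1) (v.get 2)) 0 1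
  have hF : Computable F := by
    have hg : ∀ i : Fin 3, Computable fun v : List.Vector ℕ 3 => v.get i := fun i =>
      (Primrec.vector_get.comp .id (.const i)).to_comp
    exact Computable.cond (hS.comp ((hg 0).pair ((hg 1).pair (hg 2)))) (.const 0) (.const 1)
  have h := TestableGraph.of_partrec' (Nat.Partrec'.of_part hF) 4 (fun i => i) 3
    (fun i => by omega) (by omega)
  refine ((Testable.zero _ 3).and h).exists_reg.of_iff fun σ => ?_
  have : ∀ σ : ℕ → ℕ, F (List.Vector.ofFn fun i : Fin 3 => σ i) =
      cond (S (σ 0) (σ 1) (σ 2)) 0 1 := fun σ => by simp [F]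
  cases hs : S (σ 0) (σ 1) (σ 2) <;> simp [this, hs]

/-- A program that extends a (reversed) list by an arbitrary entry, after a test of the list. -/
theorem exists_extend {R : ℕ → List ℕ → Bool} (hR : Computable₂ R) :
    ∃ p : Prog, ∀ a (l : List ℕ) τ, p.Run (pairRegs a (Encodable.encode l)) τ ↔
      R a l.reverse = false ∧ ∃ m, τ = pairRegs a (Encodable.encode (m :: l)) := by
  let S : ℕ → ℕ → ℕ → Bool := fun a c c' =>
    !(R a (Denumerable.ofNat (List ℕ) c).reverse) && (!(c' == 0) &&
      (Encodable.encode (Denumerable.ofNat (List ℕ) c').tail == c))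
  have hS : Computable fun x : ℕ × ℕ × ℕ => S x.1 x.2.1 x.2.2 := by
    have h₁ : Computable fun x : ℕ × ℕ × ℕ =>
        !(R x.1 (Denumerable.ofNat (List ℕ) x.2.1).reverse) :=
      Primrec.not.to_comp.comp (hR.comp .fst
        (Computable.list_reverse.comp ((Computable.ofNat _).comp (Computable.fst.comp .snd))))
    have h₂ : Computable fun x : ℕ × ℕ × ℕ => !(x.2.2 == 0) :=
      (Primrec.not.comp (Primrec.beq.comp (Primrec.snd.comp .snd) (.const 0))).to_comp
    have h₃ : Computable fun x : ℕ × ℕ × ℕ =>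
        (Encodable.encode (Denumerable.ofNat (List ℕ) x.2.2).tail == x.2.1) :=
      (Primrec.beq.comp (Primrec.encode.comp (Primrec.list_tail.comp
        ((Primrec.ofNat _).comp (Primrec.snd.comp .snd)))) (Primrec.fst.comp .snd)).to_comp
    exact Primrec.and.to_comp.comp h₁ (Primrec.and.to_comp.comp h₂ h₃)
  obtain ⟨p, hp⟩ := testable_three hS
  have hspec : ∀ a (l : List ℕ) c', S a (Encodable.encode l) c' = true ↔
      R a l.reverse = false ∧ ∃ m, c' = Encodable.encode (m :: l) := by
    intro a l c'
    obtain ⟨l', rfl⟩ : ∃ l' : List ℕ, c' = Encodable.encode l' :=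
      ⟨Denumerable.ofNat _ c', by simp⟩
    cases l' with
    | nil => simp [S, Encodable.encode_list_nil, Encodable.encode_list_cons]
    | cons m' l' =>
      have h0 : Encodable.encode (m' :: l') ≠ 0 := by
        rw [Encodable.encode_list_cons]; exact Nat.succ_ne_zero _
      have h1 : (Encodable.encode l' = Encodable.encode l) ↔ l' = l := Encodable.encode_inj
      have h2 : ∀ m, (Encodable.encode (m' :: l') = Encodable.encode (m :: l)) ↔
        m' :: l' = m :: l := fun m => Encodable.encode_inj
      simp only [S, Denumerable.ofNat_encode, List.tail_cons, Bool.and_eq_true, Bool.not_eq_true',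
        beq_eq_false_iff_ne, beq_iff_eq, ne_eq, h0, not_false_eq_true, true_and, h1, h2,
        List.cons.injEq, exists_eq_left']
  refine ⟨.seq (.havoc 2) (.seq p (.seq (.havoc 1) (.seq (.eq 1 2) (.clear 2)))),
    fun a l τ => ?_⟩
  have hz : ∀ c c' i, 3 ≤ i → update (pairRegs a c) 2 c' i = 0 := fun c c' i hi => by
    simp only [pairRegs]
    rw [update_of_ne (by omega), update_of_ne (by omega), update_of_ne (by omega)]
  have hend : ∀ c c', update (update (update (pairRegs a c) 2 c') 1 c') 2 0 = pairRegs a c' :=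
    fun c c' => by
      ext i
      simp only [pairRegs, update_apply]
      split_ifs <;> first | rfl | omega
  have hS2 : ∀ c c', S (update (pairRegs a c) 2 c' 0) (update (pairRegs a c) 2 c' 1)
      (update (pairRegs a c) 2 c' 2) = S a c c' := fun c c' => by simp [pairRegs]
  constructor
  · rintro ⟨ρ₁, h₁, ρ₂, h₂, ρ₃, h₃, ρ₄, ⟨h₄, rfl⟩, h₅⟩
    obtain ⟨c', rfl⟩ := Prog.run_havoc.1 h₁
    obtain ⟨h, rfl⟩ := (hp _ (hz _ c') _).1 h₂
    obtain ⟨c'', rfl⟩ := Prog.run_havoc.1 h₃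
    obtain rfl : c'' = c' := by simpa using h₄
    rw [hS2, hspec] at h
    obtain ⟨hr, m, rfl⟩ := h
    exact ⟨hr, m, by rw [Prog.run_clear.1 h₅, hend]⟩
  · rintro ⟨hr, m, rfl⟩
    exact ⟨_, Prog.run_havoc.2 ⟨Encodable.encode (m :: l), rfl⟩, _,
      (hp _ (hz _ _) _).2 ⟨(hS2 _ _).trans ((hspec _ _ _).2 ⟨hr, m, rfl⟩), rfl⟩, _,
      Prog.run_havoc.2 ⟨Encodable.encode (m :: l), rfl⟩, _, ⟨by simp, rfl⟩,
      Prog.run_clear.2 (hend _ _).symm⟩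

/-- Existence of an infinite branch of a computable tree, as a repeated execution of a program. -/
theorem exists_prog_iterates {R : ℕ → List ℕ → Bool} (hR : Computable₂ R) :
    ∃ p : Prog, ∀ a, (∃ s : ℕ → ℕ → ℕ, s 0 = pairRegs a 0 ∧ ∀ i, p.Run (s i) (s (i + 1))) ↔
      ∃ f : ℕ → ℕ, ∀ k, R a ((List.range k).map f) = false := by
  obtain ⟨p, hp⟩ := exists_extend hR
  refine ⟨p, fun a => ⟨?_, ?_⟩⟩
  · rintro ⟨s, hs0, hs⟩
    have h : ∀ i, ∃ l : List ℕ, s i = pairRegs a (Encodable.encode l) := by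
      intro i
      induction i with
      | zero => exact ⟨[], by simpa using hs0⟩
      | succ i ih =>
        obtain ⟨l, hl⟩ := ih
        obtain ⟨-, m, hm⟩ := (hp _ _ _).1 (hl ▸ hs i)
        exact ⟨_, hm⟩
    choose l hl using h
    have h : ∀ i, R a (l i).reverse = false ∧ ∃ m, l (i + 1) = m :: l i := by
      intro i
      obtain ⟨h, m, hm⟩ := (hp _ _ _).1 (hl i ▸ hs i)
      rw [hl] at hm
      exact ⟨h, m, Encodable.encode_injective (pairRegs_injective a hm)⟩
    choose h f hf using h
    refine ⟨f, fun k => ?_⟩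
    suffices ∀ k, (List.range k).map f = (l k).reverse by rw [this]; exact h k
    intro k
    induction k with
    | zero =>
      have : l 0 = [] := Encodable.encode_injective
        (pairRegs_injective a ((hl 0).symm.trans (hs0.trans (by simp))))
      simp [this]
    | succ k ih => rw [List.range_succ, List.map_append, ih, hf]; simp
  · rintro ⟨f, hf⟩
    refine ⟨fun i => pairRegs a (Encodable.encode ((List.range i).map f).reverse), by simp,
      fun i => (hp _ _ _).2 ⟨by simpa using hf i, f i, ?_⟩⟩
    simp [List.range_succ]

/-- A tape together with a head position. -/
abbrev TapeHead : Type := (ℕ → ℕ) × ℕ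

/-- A letter `(s, s', d)` is an instruction to read `s`, write `s'` and move in direction `d`
(right for `true`). -/
abbrev Instr : Type := ℕ × ℕ × Bool

/-- Execution of an instruction. -/
def Instr.Exec (l : Instr) (x y : TapeHead) : Prop :=
  x.1 x.2 = l.1 ∧ (l.2.2 = true ∨ 1 ≤ x.2) ∧
    y = (update x.1 x.2 l.2.1, if l.2.2 then x.2 + 1 else x.2 - 1)

/-- Execution of a word of instructions. -/
def ExecWord : List Instr → TapeHead → TapeHead → Prop
  | [], x, y => y = x
  | l :: w, x, y => ∃ z, l.Exec x z ∧ ExecWord w z y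

theorem execWord_append {u v : List Instr} {x y : TapeHead} :
    ExecWord (u ++ v) x y ↔ ∃ z, ExecWord u x z ∧ ExecWord v z y := by
  induction u generalizing x with
  | nil => simp [ExecWord]
  | cons l u ih =>
    simp only [List.cons_append, ExecWord, ih]
    constructor
    · rintro ⟨z, h, z', h', h''⟩
      exact ⟨z', ⟨z, h, h'⟩, h''⟩
    · rintro ⟨z', ⟨z, h, h'⟩, h''⟩
      exact ⟨z, h, z', h', h''⟩

/-- The relation `r` is that of executing some word of `L`; the language `L` is regular and all of
its words consist of instructions from `s`. -/
structure Realizes (s : Set Instr) (L : Language Instr) (r : TapeHead → TapeHead → Prop) :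
    Prop where
  isRegular : L.IsRegular
  letters_mem : ∀ w ∈ L, ∀ l ∈ w, l ∈ s
  iff : ∀ x y, r x y ↔ ∃ w ∈ L, ExecWord w x y

/-- The relation of executing one instruction from a set. -/
def execOne (A : Set Instr) (x y : TapeHead) : Prop := ∃ l ∈ A, l.Exec x y

namespace Realizes

variable {s : Set Instr} {L M : Language Instr} {r t : TapeHead → TapeHead → Prop}

theorem one {A : Set Instr} (h : A ⊆ s) :
    Realizes s (Language.singletons A) (execOne A) where
  isRegular := Language.isRegular_singletons A
  letters_mem := by
    rintro _ ⟨a, ha, rfl⟩ l hl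
    obtain rfl := List.mem_singleton.1 hl
    exact h ha
  iff x y := by
    constructor
    · rintro ⟨l, hl, h⟩
      exact ⟨[l], ⟨l, hl, rfl⟩, y, h, rfl⟩
    · rintro ⟨_, ⟨l, hl, rfl⟩, z, h, rfl⟩
      exact ⟨l, hl, h⟩

theorem mul (hL : Realizes s L r) (hM : Realizes s M t) :
    Realizes s (L * M) (Relation.Comp r t) where
  isRegular := hL.isRegular.mul hM.isRegular
  letters_mem := by
    rintro _ ⟨u, hu, v, hv, rfl⟩ l hl
    rcases List.mem_append.1 hl with hl | hl
    exacts [hL.letters_mem _ hu _ hl, hM.letters_mem _ hv _ hl]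
  iff x y := by
    constructor
    · rintro ⟨z, h, h'⟩
      obtain ⟨u, hu, h⟩ := (hL.iff _ _).1 h
      obtain ⟨v, hv, h'⟩ := (hM.iff _ _).1 h'
      exact ⟨u ++ v, ⟨u, hu, v, hv, rfl⟩, execWord_append.2 ⟨z, h, h'⟩⟩
    · rintro ⟨_, ⟨u, hu, v, hv, rfl⟩, h⟩
      obtain ⟨z, h, h'⟩ := execWord_append.1 h
      exact ⟨z, (hL.iff _ _).2 ⟨u, hu, h⟩, (hM.iff _ _).2 ⟨v, hv, h'⟩⟩

theorem kstar (hL : Realizes s L r) : Realizes s (L∗) (Relation.ReflTransGen r) where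
  isRegular := hL.isRegular.kstar
  letters_mem := by
    rintro _ ⟨ws, rfl, hws⟩ l hl
    obtain ⟨w, hw, hl⟩ := List.mem_flatten.1 hl
    exact hL.letters_mem _ (hws _ hw) _ hl
  iff x y := by
    constructor
    · intro h
      induction h using Relation.ReflTransGen.head_induction_on with
      | refl => exact ⟨[], Language.nil_mem_kstar _, rfl⟩
      | head h _ ih =>
        obtain ⟨_, ⟨ws, rfl, hws⟩, h'⟩ := ih
        obtain ⟨w, hw, h⟩ := (hL.iff _ _).1 h
        refine ⟨w ++ ws.flatten, ⟨w :: ws, rfl, ?_⟩, execWord_append.2 ⟨_, h, h'⟩⟩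
        simpa [hw] using hws
    · rintro ⟨_, ⟨ws, rfl, hws⟩, h⟩
      induction ws generalizing x with
      | nil => exact h ▸ .refl
      | cons w ws ih =>
        obtain ⟨z, h, h'⟩ := execWord_append.1 h
        exact .head ((hL.iff _ _).2 ⟨w, hws w (by simp), h⟩)
          (ih _ (fun y hy => hws y (by simp [hy])) h')

end Realizes

/-- The tape symbol that marks the left end of the tape. -/
def marker (k : ℕ) : ℕ := 2 ^ (k + 1)

/-- The blank symbol. -/
def blankSymbol (k : ℕ) : ℕ := 2 ^ (k + 1) + 1

/-- The registers below `k` marked by a symbol. The symbols `0`, `1`, the marker and the blank do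
not mark any register. -/
def marks (k s : ℕ) : Set ℕ := {r | r < k ∧ s < 2 ^ (k + 1) ∧ s.testBit (r + 1) = true}

theorem mem_marks {k s r : ℕ} :
    r ∈ marks k s ↔ r < k ∧ s < 2 ^ (k + 1) ∧ s.testBit (r + 1) = true := Iff.rfl

theorem marks_subset (k s : ℕ) : marks k s ⊆ Set.Iio k := fun _ h => h.1

theorem exists_marks_eq {k : ℕ} {A : Set ℕ} (hA : A ⊆ Set.Iio k) :
    ∃ s < 2 ^ (k + 1), marks k s = A := by
  classical
  refine ⟨Nat.ofBits fun i : Fin (k + 1) => decide (∃ r ∈ A, r + 1 = i),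
    Nat.ofBits_lt_two_pow _, Set.ext fun r => ?_⟩
  rw [mem_marks]
  constructor
  · rintro ⟨hr, -, h⟩
    rw [Nat.testBit_ofBits_lt _ _ (by omega)] at h
    simpa using h
  · intro h
    have hr : r < k := hA h
    refine ⟨hr, Nat.ofBits_lt_two_pow _, ?_⟩
    rw [Nat.testBit_ofBits_lt _ _ (by omega)]
    simpa using h

theorem marks_lt_two {k s : ℕ} (hs : s < 2) : marks k s = ∅ := by
  refine Set.eq_empty_of_forall_notMem fun r hr => ?_
  have := (mem_marks.1 hr).2.2
  rw [Nat.testBit_lt_two_pow (hs.trans_le (by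
    rw [pow_succ]; have := Nat.one_le_two_pow (n := r); omega))] at this
  exact Bool.noConfusion this

theorem marks_blankSymbol (k : ℕ) : marks k (blankSymbol k) = ∅ := by
  refine Set.eq_empty_of_forall_notMem fun r hr => ?_
  have := (mem_marks.1 hr).2.1
  simp [blankSymbol] at this

/-- The tape `T` is bounded to the left by a marker, and its other cells carry the marks `C`. -/
def HasMarks (k : ℕ) (T : ℕ → ℕ) (C : ℕ → Set ℕ) : Prop :=
  T 0 = marker k ∧ ∀ i, 1 ≤ i → T i ≠ marker k ∧ T i ≤ blankSymbol k ∧ marks k (T i) = C i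

/-- The marks that represent register contents in unary. -/
def unary (k : ℕ) (σ : ℕ → ℕ) (i : ℕ) : Set ℕ := {r | r < k ∧ i ≤ σ r}

theorem mem_unary {k i r : ℕ} {σ : ℕ → ℕ} : r ∈ unary k σ i ↔ r < k ∧ i ≤ σ r := Iff.rfl

/-- The instructions over the alphabet for `k` registers. -/
def instrs (k : ℕ) : Set Instr := {l | l.1 ≤ blankSymbol k ∧ l.2.1 < blankSymbol k}

/-- Instructions that change marks according to the relation `U` and move in direction `d`. -/
def edit (k : ℕ) (d : Bool) (U : Set ℕ → Set ℕ → Prop) : Set Instr :=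
  {l | l.1 ≤ blankSymbol k ∧ l.1 ≠ marker k ∧ l.2.1 < 2 ^ (k + 1) ∧ l.2.2 = d ∧
    U (marks k l.1) (marks k l.2.1)}

/-- Instructions that preserve marks that satisfy `P`. -/
def keep (k : ℕ) (d : Bool) (P : Set ℕ → Prop) : Set Instr := edit k d fun A A' => P A ∧ A' = A

theorem edit_subset {k : ℕ} {d : Bool} {U : Set ℕ → Set ℕ → Prop} : edit k d U ⊆ instrs k :=
  fun l hl => ⟨hl.1, by have := hl.2.2.1; simp only [blankSymbol]; omega⟩

section

variable {k h : ℕ} {T : ℕ → ℕ} {C : ℕ → Set ℕ} {d : Bool} {y : TapeHead}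

theorem HasMarks.edit {U : Set ℕ → Set ℕ → Prop} (hT : HasMarks k T C)
    (hy : execOne (edit k d U) (T, h) y) :
    1 ≤ h ∧ ∃ A, U (C h) A ∧ HasMarks k y.1 (update C h A) ∧
      y.2 = if d then h + 1 else h - 1 := by
  obtain ⟨⟨s, s', d'⟩, ⟨hs, hs', hs'', rfl, hU⟩, hs₁, -, rfl⟩ := hy
  simp only at hs₁ hs hs' hs'' hU
  have h1 : 1 ≤ h := by
    rcases Nat.eq_zero_or_pos h with rfl | h0
    · exact absurd (hs₁.symm.trans hT.1) hs'
    · exact h0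
  subst hs₁
  rw [(hT.2 h h1).2.2] at hU
  refine ⟨h1, _, hU, ⟨?_, fun i hi => ?_⟩, rfl⟩
  · simp only
    rw [update_of_ne (by omega)]; exact hT.1
  · rcases eq_or_ne i h with rfl | hne
    · simp only [update_self, marker, blankSymbol]
      exact ⟨by omega, by omega, trivial⟩
    · simp only
      rw [update_of_ne hne, update_of_ne hne]; exact hT.2 i hi

theorem HasMarks.exists_edit {U : Set ℕ → Set ℕ → Prop} (hT : HasMarks k T C) (h1 : 1 ≤ h)
    {A : Set ℕ} (hA : A ⊆ Set.Iio k) (hU : U (C h) A) :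
    ∃ T', execOne (ChaseTermination.edit k d U) (T, h) (T', if d then h + 1 else h - 1) ∧
      HasMarks k T' (update C h A) := by
  obtain ⟨s', hs', rfl⟩ := exists_marks_eq hA
  obtain ⟨hT1, hT2, hT3⟩ := hT.2 h h1
  refine ⟨update T h s', ⟨(T h, s', d), ⟨hT2, hT1, hs', rfl, hT3.symm ▸ hU⟩, rfl, Or.inr h1, rfl⟩,
    ?_, fun i hi => ?_⟩
  · rw [update_of_ne (by omega)]; exact hT.1
  · rcases eq_or_ne i h with rfl | hne
    · simp only [update_self, marker, blankSymbol]
      exact ⟨by omega, by omega, trivial⟩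
    · rw [update_of_ne hne, update_of_ne hne]; exact hT.2 i hi

theorem HasMarks.keep {P : Set ℕ → Prop} (hT : HasMarks k T C)
    (hy : execOne (keep k d P) (T, h) y) :
    1 ≤ h ∧ P (C h) ∧ HasMarks k y.1 C ∧ y.2 = if d then h + 1 else h - 1 := by
  obtain ⟨h1, A, ⟨hP, rfl⟩, hy, h2⟩ := hT.edit hy
  exact ⟨h1, hP, by simpa using hy, h2⟩

theorem HasMarks.exists_keep {P : Set ℕ → Prop} (hT : HasMarks k T C) (h1 : 1 ≤ h)
    (hP : P (C h)) :
    ∃ T', execOne (ChaseTermination.keep k d P) (T, h) (T', if d then h + 1 else h - 1) ∧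
      HasMarks k T' C := by
  have hC : C h ⊆ Set.Iio k := (hT.2 h h1).2.2 ▸ marks_subset k _
  have := hT.exists_edit (d := d) (U := fun A A' => P A ∧ A' = A) h1 hC ⟨hP, rfl⟩
  rwa [update_eq_self] at this

end

/-- Move the head to the cell next to the marker. -/
def rewind (k : ℕ) : TapeHead → TapeHead → Prop :=
  Relation.Comp (Relation.ReflTransGen (execOne (keep k false fun _ => True)))
    (execOne {(marker k, marker k, true)})

/-- Move the head to the right, over cells that carry all marks in `X`. -/
def scan (k : ℕ) (X : Set ℕ) : TapeHead → TapeHead → Prop :=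
  Relation.ReflTransGen (execOne (keep k true fun A => X ⊆ A))

section

variable {k h : ℕ} {T : ℕ → ℕ} {C : ℕ → Set ℕ} {y : TapeHead} {σ : ℕ → ℕ} {X : Set ℕ}

theorem HasMarks.rewind (hT : HasMarks k T C) (hy : rewind k (T, h) y) :
    HasMarks k y.1 C ∧ y.2 = 1 := by
  obtain ⟨⟨T', h'⟩, h₁, ⟨_, rfl, h₂, -, rfl⟩⟩ := hy
  have hT' : HasMarks k T' C := by
    suffices ∀ z, Relation.ReflTransGen (execOne (ChaseTermination.keep k false fun _ => True))
        (T, h) z → HasMarks k z.1 C from this _ h₁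
    intro z hz
    induction hz with
    | refl => exact hT
    | tail _ h ih => exact (ih.keep h).2.2.1
  obtain rfl : h' = 0 := by
    by_contra h0
    exact (hT'.2 h' (by omega)).1 h₂
  simp only at h₂ ⊢
  rw [← h₂, update_eq_self]
  exact ⟨hT', rfl⟩

theorem HasMarks.exists_rewind (hT : HasMarks k T C) (h : ℕ) :
    ∃ T', ChaseTermination.rewind k (T, h) (T', 1) ∧ HasMarks k T' C := by
  induction h generalizing T with
  | zero =>
    refine ⟨T, ⟨(T, 0), .refl, (marker k, marker k, true), rfl, hT.1, Or.inl rfl, ?_⟩, hT⟩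
    simp [← hT.1]
  | succ h ih =>
    obtain ⟨T', h₁, hT'⟩ := hT.exists_keep (d := false) (P := fun _ => True)
      (Nat.le_add_left 1 h) trivial
    obtain ⟨T'', ⟨z, h₂, h₃⟩, hT''⟩ := ih hT'
    exact ⟨T'', ⟨z, .head h₁ h₂, h₃⟩, hT''⟩

theorem HasMarks.scan (hT : HasMarks k T (unary k σ)) (hy : scan k X (T, 1) y) :
    HasMarks k y.1 (unary k σ) ∧ 1 ≤ y.2 ∧ ∀ x ∈ X, y.2 ≤ σ x + 1 := by
  change Relation.ReflTransGen _ _ _ at hy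
  induction hy with
  | refl => exact ⟨hT, le_rfl, fun x _ => Nat.le_add_left ..⟩
  | tail _ h ih =>
    obtain ⟨h₁, h₂, h₃, h₄⟩ := ih.1.keep h
    simp only [if_true] at h₄
    refine ⟨h₃, by omega, fun x hx => ?_⟩
    have := (mem_unary.1 (h₂ hx)).2
    omega

theorem HasMarks.exists_scan (hT : HasMarks k T (unary k σ)) {n : ℕ}
    (hn : ∀ x ∈ X, x < k ∧ n ≤ σ x) :
    ∃ T', ChaseTermination.scan k X (T, 1) (T', n + 1) ∧ HasMarks k T' (unary k σ) := by
  induction n with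
  | zero => exact ⟨T, .refl, hT⟩
  | succ n ih =>
    obtain ⟨T', h, hT'⟩ := ih fun x hx => ⟨(hn x hx).1, by have := (hn x hx).2; omega⟩
    obtain ⟨T'', h', hT''⟩ := hT'.exists_keep (d := true) (P := fun A => X ⊆ A)
      (h := n + 1) (Nat.le_add_left 1 n) (fun x hx => hn x hx)
    exact ⟨T'', .tail h h', hT''⟩

end

theorem exists_realizes_rewind (k : ℕ) : ∃ L, [] ∉ L ∧ Realizes (instrs k) L (rewind k) := by
  refine ⟨_, ?_, (Realizes.one edit_subset).kstar.mul (Realizes.one ?_)⟩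
  · rintro ⟨_, -, _, ⟨a, -, rfl⟩, h⟩
    simp at h
  · rintro _ rfl
    exact ⟨Nat.le_succ _, Nat.lt_succ_self _⟩

theorem exists_realizes_scan (k : ℕ) (X : Set ℕ) : ∃ L, Realizes (instrs k) L (scan k X) :=
  ⟨_, (Realizes.one edit_subset).kstar⟩

/-- The relation `r` on tapes simulates the program `p`. -/
structure Simulates (k : ℕ) (p : Prog) (r : TapeHead → TapeHead → Prop) : Prop where
  sound : ∀ T h σ y, HasMarks k T (unary k σ) → r (T, h) y →
    ∃ τ, p.Run σ τ ∧ HasMarks k y.1 (unary k τ)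
  complete : ∀ T h σ τ, HasMarks k T (unary k σ) → p.Run σ τ →
    ∃ y, r (T, h) y ∧ HasMarks k y.1 (unary k τ)

theorem unary_update_succ {k x : ℕ} (hx : x < k) (σ : ℕ → ℕ) :
    unary k (update σ x (σ x + 1)) =
      update (unary k σ) (σ x + 1) (insert x (unary k σ (σ x + 1))) := by
  ext i r
  rcases eq_or_ne i (σ x + 1) with rfl | hi <;> rcases eq_or_ne r x with rfl | hr
  · simp [mem_unary, hx]
  · simp [mem_unary, hr]
  · simp only [mem_unary, update_self, update_of_ne hi]; omega
  · simp [mem_unary, hr, hi]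

theorem unary_update_pred {k x n : ℕ} (hx : x < k) {σ : ℕ → ℕ} (hn : σ x = n + 1) :
    unary k (update σ x n) = update (unary k σ) (n + 1) (unary k σ (n + 1) \ {x}) := by
  ext i r
  rcases eq_or_ne i (n + 1) with rfl | hi <;> rcases eq_or_ne r x with rfl | hr
  · simp [mem_unary]
  · simp [mem_unary, hr]
  · simp only [mem_unary, update_self, update_of_ne hi]; omega
  · simp [mem_unary, hr, hi]

namespace Simulates

variable {k x : ℕ}

theorem inc (hx : x < k) : Simulates k (.inc x) (Relation.Comp (rewind k)
    (Relation.Comp (scan k {x}) (execOne (edit k true fun A A' => x ∉ A ∧ A' = insert x A)))) where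
  sound T h σ y hT := by
    rintro ⟨⟨T₁, h₁⟩, hr, ⟨T₂, h₂⟩, hs, he⟩
    obtain ⟨hT₁, rfl⟩ := hT.rewind hr
    obtain ⟨hT₂, h1, hle⟩ := hT₁.scan hs
    obtain ⟨-, A, ⟨hA, rfl⟩, hy, -⟩ := hT₂.edit he
    have := hle x rfl
    rw [mem_unary] at hA
    obtain rfl : h₂ = σ x + 1 := by simp only at this; omega
    exact ⟨_, rfl, by rw [unary_update_succ hx]; exact hy⟩
  complete T h σ τ hT := by
    rintro rfl
    obtain ⟨T₁, hr, hT₁⟩ := hT.exists_rewind h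
    obtain ⟨T₂, hs, hT₂⟩ := hT₁.exists_scan (X := {x}) (n := σ x)
      (by rintro _ rfl; exact ⟨hx, le_rfl⟩)
    obtain ⟨T₃, he, hT₃⟩ := hT₂.exists_edit (d := true) (Nat.le_add_left 1 (σ x))
      (U := fun A A' => x ∉ A ∧ A' = insert x A) (A := insert x (unary k σ (σ x + 1)))
      (Set.insert_subset hx fun r hr => hr.1) ⟨by simp [mem_unary], rfl⟩
    exact ⟨_, ⟨_, hr, _, hs, he⟩, by rw [unary_update_succ hx]; exact hT₃⟩

theorem dec (hx : x < k) : Simulates k (.dec x) (Relation.Comp (rewind k)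
    (Relation.Comp (scan k {x})
      (Relation.Comp (execOne (edit k true fun A A' => x ∈ A ∧ A' = A \ {x}))
        (execOne (keep k true fun A => x ∉ A))))) where
  sound T h σ y hT := by
    rintro ⟨⟨T₁, h₁⟩, hr, ⟨T₂, h₂⟩, hs, ⟨T₃, h₃⟩, he, hk⟩
    obtain ⟨hT₁, rfl⟩ := hT.rewind hr
    obtain ⟨hT₂, h1, hle⟩ := hT₁.scan hs
    obtain ⟨-, A, ⟨hA, rfl⟩, hT₃, rfl⟩ := hT₂.edit he
    obtain ⟨-, hA', hy, -⟩ := hT₃.keep hk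
    simp only [if_true] at hA' h1
    rw [update_of_ne (by omega), mem_unary] at hA'
    rw [mem_unary] at hA
    obtain ⟨n, rfl⟩ : ∃ n, h₂ = n + 1 := ⟨h₂ - 1, by omega⟩
    have hn : σ x = n + 1 := by omega
    exact ⟨_, ⟨n, hn, rfl⟩, by rw [unary_update_pred hx hn]; exact hy⟩
  complete T h σ τ hT := by
    rintro ⟨n, hn, rfl⟩
    obtain ⟨T₁, hr, hT₁⟩ := hT.exists_rewind h
    obtain ⟨T₂, hs, hT₂⟩ := hT₁.exists_scan (X := {x}) (n := n)
      (by rintro _ rfl; exact ⟨hx, by omega⟩)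
    obtain ⟨T₃, he, hT₃⟩ := hT₂.exists_edit (d := true) (Nat.le_add_left 1 n)
      (U := fun A A' => x ∈ A ∧ A' = A \ {x}) (A := unary k σ (n + 1) \ {x})
      (fun r hr => hr.1.1) ⟨⟨hx, hn.ge⟩, rfl⟩
    obtain ⟨T₄, hk, hT₄⟩ := hT₃.exists_keep (d := true) (P := fun A => x ∉ A)
      (Nat.le_add_left 1 (n + 1))
      (by rw [update_of_ne (by omega), mem_unary]; omega)
    exact ⟨_, ⟨_, hr, _, hs, _, he, hk⟩, by rw [unary_update_pred hx hn]; exact hT₄⟩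

theorem zero (hx : x < k) : Simulates k (.zero x)
    (Relation.Comp (rewind k) (execOne (keep k true fun A => x ∉ A))) where
  sound T h σ y hT := by
    rintro ⟨⟨T₁, h₁⟩, hr, hk⟩
    obtain ⟨hT₁, rfl⟩ := hT.rewind hr
    obtain ⟨-, hA, hy, -⟩ := hT₁.keep hk
    rw [mem_unary] at hA
    exact ⟨σ, ⟨by omega, rfl⟩, hy⟩
  complete T h σ τ hT := by
    rintro ⟨h0, rfl⟩
    obtain ⟨T₁, hr, hT₁⟩ := hT.exists_rewind h
    obtain ⟨T₂, hk, hT₂⟩ := hT₁.exists_keep (d := true) (P := fun A => x ∉ A) le_rfl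
      (by rw [mem_unary]; omega)
    exact ⟨_, ⟨_, hr, hk⟩, hT₂⟩

theorem eq {x' : ℕ} (hx : x < k) (hx' : x' < k) : Simulates k (.eq x x')
    (Relation.Comp (rewind k) (Relation.Comp (scan k {x, x'})
      (execOne (keep k true fun A => x ∉ A ∧ x' ∉ A)))) where
  sound T h σ y hT := by
    rintro ⟨⟨T₁, h₁⟩, hr, ⟨T₂, h₂⟩, hs, hk⟩
    obtain ⟨hT₁, rfl⟩ := hT.rewind hr
    obtain ⟨hT₂, h1, hle⟩ := hT₁.scan hs
    obtain ⟨-, ⟨hA, hA'⟩, hy, -⟩ := hT₂.keep hk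
    have h₁ := hle x (by simp)
    have h₂ := hle x' (by simp)
    rw [mem_unary] at hA hA'
    simp only at h₁ h₂ h1
    exact ⟨σ, ⟨by omega, rfl⟩, hy⟩
  complete T h σ τ hT := by
    rintro ⟨h0, rfl⟩
    obtain ⟨T₁, hr, hT₁⟩ := hT.exists_rewind h
    obtain ⟨T₂, hs, hT₂⟩ := hT₁.exists_scan (X := {x, x'}) (n := τ x)
      (by rintro _ (rfl | rfl); exacts [⟨hx, le_rfl⟩, ⟨hx', h0.le⟩])
    obtain ⟨T₃, hk, hT₃⟩ := hT₂.exists_keep (d := true) (P := fun A => x ∉ A ∧ x' ∉ A)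
      (Nat.le_add_left 1 (τ x)) (by rw [mem_unary, mem_unary]; omega)
    exact ⟨_, ⟨_, hr, _, hs, hk⟩, hT₃⟩

variable {p q : Prog} {r s : TapeHead → TapeHead → Prop}

theorem seq (hp : Simulates k p r) (hq : Simulates k q s) :
    Simulates k (.seq p q) (Relation.Comp r s) where
  sound T h σ y hT := by
    rintro ⟨⟨T', h'⟩, h₁, h₂⟩
    obtain ⟨ρ, hρ, hT'⟩ := hp.sound _ _ _ _ hT h₁
    obtain ⟨τ, hτ, hy⟩ := hq.sound _ _ _ _ hT' h₂
    exact ⟨τ, ⟨ρ, hρ, hτ⟩, hy⟩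
  complete T h σ τ hT := by
    rintro ⟨ρ, hρ, hτ⟩
    obtain ⟨⟨T', h'⟩, h₁, hT'⟩ := hp.complete _ h _ _ hT hρ
    obtain ⟨y, h₂, hy⟩ := hq.complete _ h' _ _ hT' hτ
    exact ⟨y, ⟨_, h₁, h₂⟩, hy⟩

theorem star (hp : Simulates k p r) : Simulates k (.star p) (Relation.ReflTransGen r) where
  sound T h σ y hT hy := by
    induction hy with
    | refl => exact ⟨σ, .refl, hT⟩
    | tail _ h ih =>
      obtain ⟨ρ, hρ, hT'⟩ := ih
      obtain ⟨τ, hτ, hy⟩ := hp.sound _ _ _ _ hT' h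
      exact ⟨τ, .tail hρ hτ, hy⟩
  complete T h σ τ hT hτ := by
    change Relation.ReflTransGen _ _ _ at hτ
    induction hτ with
    | refl => exact ⟨_, .refl, hT⟩
    | tail _ h ih =>
      obtain ⟨⟨T', h'⟩, h₁, hT'⟩ := ih
      obtain ⟨y, h₂, hy⟩ := hp.complete _ h' _ _ hT' h
      exact ⟨y, .tail h₁ h₂, hy⟩

end Simulates

theorem exists_simulates {k : ℕ} (p : Prog) (hp : p.width ≤ k) :
    ∃ L r, Realizes (instrs k) L r ∧ Simulates k p r := by
  obtain ⟨_, -, hw⟩ := exists_realizes_rewind k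
  have hs := fun X => (exists_realizes_scan k X).choose_spec
  induction p with
  | inc x =>
    exact ⟨_, _, hw.mul ((hs _).mul (.one edit_subset)), .inc hp⟩
  | dec x =>
    exact ⟨_, _, hw.mul ((hs _).mul ((Realizes.one edit_subset).mul (.one edit_subset))), .dec hp⟩
  | zero x => exact ⟨_, _, hw.mul (.one edit_subset), .zero hp⟩
  | eq x y =>
    simp only [Prog.width] at hp
    exact ⟨_, _, hw.mul ((hs _).mul (.one edit_subset)), .eq (by omega) (by omega)⟩
  | seq p q ihp ihq =>
    simp only [Prog.width] at hp
    obtain ⟨_, _, h₁, h₂⟩ := ihp (by omega)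
    obtain ⟨_, _, h₃, h₄⟩ := ihq (by omega)
    exact ⟨_, _, h₁.mul h₃, h₂.seq h₄⟩
  | star p ih =>
    obtain ⟨_, _, h₁, h₂⟩ := ih hp
    exact ⟨_, _, h₁.kstar, h₂.star⟩

/-- A simulation of `p` by nonempty words. -/
theorem exists_simulates_nonempty {k : ℕ} (p : Prog) (hp : p.width ≤ k) :
    ∃ L r, [] ∉ L ∧ Realizes (instrs k) L r ∧ Simulates k p r := by
  obtain ⟨L₀, h0, hw⟩ := exists_realizes_rewind k
  obtain ⟨L, r, hr, hs⟩ := exists_simulates p hp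
  refine ⟨_, _, ?_, hw.mul hr, fun T h σ y hT => ?_, fun T h σ τ hT hτ => ?_⟩
  · rintro ⟨u, hu, v, hv, h⟩
    exact h0 ((List.append_eq_nil_iff.1 h).1 ▸ hu)
  · rintro ⟨⟨T', h'⟩, h₁, h₂⟩
    exact hs.sound _ _ _ _ (hT.rewind h₁).1 h₂
  · obtain ⟨T', h₁, hT'⟩ := hT.exists_rewind h
    obtain ⟨y, h₂, hy⟩ := hs.complete _ 1 _ _ hT' hτ
    exact ⟨y, ⟨_, h₁, h₂⟩, hy⟩

section

variable {α : Type*} {R : α → α → Prop} {P : α → Prop} {a b : α}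

/-- There is an infinite `R`-path from `a` that visits `P` infinitely often. -/
def Recurs (R : α → α → Prop) (P : α → Prop) (a : α) : Prop :=
  ∃ c : ℕ → α, c 0 = a ∧ (∀ i, R (c i) (c (i + 1))) ∧ ∀ N, ∃ i, N ≤ i ∧ P (c i)

theorem recurs_iff_exists_step : Recurs R P a ↔ ∃ b, R a b ∧ Recurs R P b := by
  constructor
  · rintro ⟨c, rfl, hc, hP⟩
    refine ⟨c 1, hc 0, fun i => c (i + 1), rfl, fun i => hc (i + 1), fun N => ?_⟩
    obtain ⟨i, hi, h⟩ := hP (N + 1)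
    exact ⟨i - 1, by omega, by
      show P (c (i - 1 + 1)); rwa [Nat.sub_add_cancel (by omega)]⟩
  · rintro ⟨b, hab, c, rfl, hc, hP⟩
    refine ⟨fun i => i.casesOn a c, rfl, ?_, fun N => ?_⟩
    · rintro (_ | i)
      exacts [hab, hc i]
    · obtain ⟨i, hi, h⟩ := hP N
      exact ⟨i + 1, by omega, h⟩

theorem recurs_iff_of_unique (h : ∀ c, R a c ↔ c = b) : Recurs R P a ↔ Recurs R P b := by
  simp [recurs_iff_exists_step (a := a), h]

/-- There is an `R`-path of length `n + 1` from `a` to `b`. -/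
def PathOfLength (R : α → α → Prop) : ℕ → α → α → Prop
  | 0, a, b => R a b
  | n + 1, a, b => ∃ z, R a z ∧ PathOfLength R n z b

theorem exists_pathOfLength (h : Relation.TransGen R a b) : ∃ n, PathOfLength R n a b := by
  induction h using Relation.TransGen.head_induction_on with
  | single h => exact ⟨0, h⟩
  | head h _ ih =>
    obtain ⟨n, hn⟩ := ih
    exact ⟨n + 1, _, h, hn⟩

theorem recurs_of_transGen {u : ℕ → α} (hu : ∀ i, Relation.TransGen R (u i) (u (i + 1)))
    (hP : ∀ i, P (u i)) : Recurs R P (u 0) := by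
  choose n hn using fun i => exists_pathOfLength (hu i)
  have key : ∀ x : {x : α × ℕ × ℕ // PathOfLength R x.2.2 x.1 (u x.2.1)},
      ∃ y : {x : α × ℕ × ℕ // PathOfLength R x.2.2 x.1 (u x.2.1)},
        R x.1.1 y.1.1 ∧ (x.1.2.2 = 0 → P y.1.1) ∧ (0 < x.1.2.2 → y.1.2.2 + 1 = x.1.2.2) := by
    rintro ⟨⟨a, i, _ | m⟩, h⟩
    · exact ⟨⟨(u i, i + 1, n i), hn i⟩, h, fun _ => hP i, by simp⟩
    · obtain ⟨z, hz, h⟩ := h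
      exact ⟨⟨(z, i, m), h⟩, hz, by simp, fun _ => rfl⟩
  choose g hg using key
  let c : ℕ → {x : α × ℕ × ℕ // PathOfLength R x.2.2 x.1 (u x.2.1)} :=
    fun i => g^[i] ⟨(u 0, 1, n 0), hn 0⟩
  have hc : ∀ i, c (i + 1) = g (c i) := fun i => iterate_succ_apply' ..
  refine ⟨fun i => (c i).1.1, rfl, fun i => by simpa only [hc] using (hg (c i)).1, fun N => ?_⟩
  obtain ⟨m, hm⟩ : ∃ m, (c N).1.2.2 = m := ⟨_, rfl⟩
  induction m generalizing N with
  | zero => exact ⟨N + 1, by omega, by simpa only [hc] using (hg (c N)).2.1 hm⟩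
  | succ m ih =>
    obtain ⟨i, hi, h⟩ := ih (N + 1) (by have := (hg (c N)).2.2 (by omega); rw [hc]; omega)
    exact ⟨i, by omega, h⟩

end

/-- A transition table. -/
abbrev Table : Type := List ((ℕ × ℕ) × (ℕ × ℕ × Bool))

/-- A step of a machine with table `F` on a tape that is infinite to the right. -/
def TableStep (F : Table) (a b : ℕ × TapeHead) : Prop :=
  ∃ l : Instr, ((a.1, l.1), (b.1, l.2)) ∈ F ∧ l.Exec a.2 b.2

/-- The configuration `ρ` with blanks added to the right of the tape. -/
def extend (K : ℕ) (ρ : Config) : ℕ × TapeHead := (ρ.2.2, (fun i => ρ.1.getD i K, ρ.2.1))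

theorem extend_succ {K b q q' h h' : ℕ} {t : List ℕ} (hh : h < t.length) :
    extend K (t.set h b ++ [K], h', q') = (q', (update (extend K (t, h, q)).2.1 h b, h')) := by
  refine Prod.ext rfl (Prod.ext (funext fun i => ?_) rfl)
  simp only [extend, List.getD_eq_getElem?_getD, update_apply]
  rcases lt_trichotomy i t.length with hi | hi | hi
  · rw [List.getElem?_append_left (by simpa using hi), List.getElem?_set]
    by_cases h1 : h = i
    · subst h1; simp [hh]
    · simp [h1, Ne.symm h1]
  · subst hi
    simp [hh.ne']
  · have : i ≠ h := by omega
    rw [List.getElem?_append_right (by simpa using hi.le), if_neg this,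
      List.getElem?_eq_none (l := t) hi.le, List.getElem?_eq_none (by simp; omega)]

theorem next_iff {M : NTM} {ρ ρ' : Config} (hρ : ρ.2.1 < ρ.1.length) :
    NTM.Next M ρ ρ' ↔ ∃ b q' h', ρ' = (ρ.1.set ρ.2.1 b ++ [M.2.1], h', q') ∧
      TableStep M.2.2 (extend M.2.1 ρ) (extend M.2.1 ρ') := by
  obtain ⟨t, h, q⟩ := ρ
  have hg : t.getD h M.2.1 = t.getD h 0 := by
    rw [List.getD_eq_getElem _ _ hρ, List.getD_eq_getElem _ _ hρ]
  constructor
  · rintro ⟨q', b, d, hM, hd, rfl⟩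
    refine ⟨b, q', _, rfl, (t.getD h 0, b, d), hM, hg, hd, ?_⟩
    rw [NTM.blank, extend_succ (q := q) hρ]
    rfl
  · rintro ⟨b, q', h', rfl, ⟨s, b', d⟩, hM, hs, hd, he⟩
    rw [extend_succ (q := q) hρ] at hM he
    obtain rfl : t.getD h 0 = s := hg ▸ hs
    have h1 := congrFun (congrArg Prod.fst he) h
    have h2 := congrArg Prod.snd he
    simp only [extend, update_self] at h1 h2
    subst h1 h2
    exact ⟨q', b, d, hM, hd, rfl⟩

theorem next_head_lt {M : NTM} {ρ ρ' : Config} (hρ : ρ.2.1 < ρ.1.length) (h : NTM.Next M ρ ρ') :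
    ρ'.2.1 < ρ'.1.length := by
  obtain ⟨q', b, d, -, -, rfl⟩ := h
  simp only [List.length_append, List.length_set, List.length_singleton]
  split_ifs <;> omega

theorem recurringFrom_iff {M : NTM} {qr : ℕ} {ρ : Config} (hρ : ρ.2.1 < ρ.1.length) :
    RecurringFrom M qr ρ ↔
      Recurs (TableStep M.2.2) (fun a => a.1 = qr) (extend M.2.1 ρ) := by
  constructor
  · rintro ⟨c, rfl, hc, hq⟩
    have hlt : ∀ i, (c i).2.1 < (c i).1.length := fun i => by
      induction i with
      | zero => exact hρ
      | succ i ih => exact next_head_lt ih (hc i)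
    refine ⟨fun i => extend M.2.1 (c i), rfl, fun i => ?_, hq⟩
    obtain ⟨_, _, _, -, h⟩ := (next_iff (hlt i)).1 (hc i)
    exact h
  · rintro ⟨c, h0, hc, hq⟩
    have key : ∀ (i : ℕ) (ρ : {ρ : Config // ρ.2.1 < ρ.1.length}),
        ∃ ρ' : {ρ : Config // ρ.2.1 < ρ.1.length}, extend M.2.1 ρ.1 = c i →
          extend M.2.1 ρ'.1 = c (i + 1) ∧ NTM.Next M ρ.1 ρ'.1 := by
      rintro i ⟨ρ, hρ⟩
      by_cases h : extend M.2.1 ρ = c i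
      · obtain ⟨l, hM, hl⟩ := h ▸ hc i
        have he : extend M.2.1 (ρ.1.set ρ.2.1 l.2.1 ++ [M.2.1], (c (i + 1)).2.2, (c (i + 1)).1) =
            c (i + 1) := by
          rw [extend_succ (q := ρ.2.2) hρ]
          refine Prod.ext rfl (Prod.ext ?_ rfl)
          rw [hl.2.2]
          rfl
        have hn : NTM.Next M ρ
            (ρ.1.set ρ.2.1 l.2.1 ++ [M.2.1], (c (i + 1)).2.2, (c (i + 1)).1) :=
          (next_iff hρ).2 ⟨_, _, _, rfl, he.symm ▸ ⟨l, hM, hl⟩⟩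
        exact ⟨⟨_, next_head_lt hρ hn⟩, fun _ => ⟨he, hn⟩⟩
      · exact ⟨⟨ρ, hρ⟩, fun h' => (h h').elim⟩
    choose g hg using key
    let u : ℕ → {ρ : Config // ρ.2.1 < ρ.1.length} := fun i => i.rec ⟨ρ, hρ⟩ g
    have hu : ∀ i, extend M.2.1 (u i).1 = c i := fun i => by
      induction i with
      | zero => exact h0.symm
      | succ i ih => exact (hg i (u i) ih).1
    refine ⟨fun i => (u i).1, rfl, fun i => (hg i (u i) (hu i)).2, fun N => ?_⟩
    obtain ⟨i, hi, h⟩ := hq N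
    exact ⟨i, hi, by rw [← h, ← hu]; rfl⟩

/-- The relation realized by a regular language of nonempty words is that of the loops of a
machine through the state `1`. -/
theorem Realizes.exists_table {s : Set Instr} (hs : s.Finite) {L : Language Instr}
    {r : TapeHead → TapeHead → Prop} (hL : Realizes s L r) (h0 : [] ∉ L) :
    ∃ (N : ℕ) (F : Table), 2 ≤ N ∧
      (∀ e ∈ F, (1 ≤ e.1.1 ∧ e.1.1 < N) ∧ (1 ≤ e.2.1 ∧ e.2.1 < N) ∧ (e.1.2, e.2.2) ∈ s) ∧
      (∀ x y, r x y → Relation.TransGen (TableStep F) (1, x) (1, y)) ∧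
      ∀ (n : ℕ) (c : ℕ → ℕ × TapeHead), (c 0).1 = 1 → (c (n + 1)).1 = 1 →
        (∀ i < n, (c (i + 1)).1 ≠ 1) → (∀ i ≤ n, TableStep F (c i) (c (i + 1))) →
        r (c 0).2 (c (n + 1)).2 := by
  obtain ⟨σ, _, D, hD⟩ := hL.isRegular
  let e := Fintype.equivFin σ
  let Rep : ℕ → σ → Prop := fun q d => q = 2 + (e d : ℕ) ∨ q = 1 ∧ d = D.start
  have hRep : ∀ {q d d'}, Rep q d → Rep q d' → d = d' := by
    rintro q d d' (h | ⟨h, rfl⟩) (h' | ⟨h', rfl⟩)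
    · exact e.injective (Fin.ext (by omega))
    · omega
    · omega
    · rfl
  have hlt : ∀ {q d}, Rep q d → 1 ≤ q ∧ q < 2 + Fintype.card σ := by
    rintro q d (h | ⟨h, rfl⟩)
    · have := (e d).2; omega
    · omega
  let S : Set ((ℕ × ℕ) × (ℕ × ℕ × Bool)) := {t | (t.1.2, t.2.2) ∈ s ∧ ∃ d, Rep t.1.1 d ∧
    (t.2.1 = 2 + (e (D.step d (t.1.2, t.2.2)) : ℕ) ∨
      t.2.1 = 1 ∧ D.step d (t.1.2, t.2.2) ∈ D.accept)}
  have hS : S.Finite := by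
    refine (((Set.finite_Iio (2 + Fintype.card σ)).prod
      ((Set.finite_Iio (2 + Fintype.card σ)).prod hs)).image
      fun z : ℕ × ℕ × Instr => ((z.1, z.2.2.1), (z.2.1, z.2.2.2))).subset ?_
    rintro ⟨⟨q, a⟩, q', l⟩ ⟨h, d, hd, h'⟩
    refine ⟨(q, q', (a, l)), ⟨(hlt hd).2, ?_, h⟩, rfl⟩
    rcases h' with h' | ⟨h', -⟩
    · exact (hlt (Or.inl h')).2
    · simp only at h'; simp only [Set.mem_Iio]; omega
  have hF : ∀ {t}, t ∈ hS.toFinset.toList ↔ t ∈ S := by simp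
  refine ⟨2 + Fintype.card σ, hS.toFinset.toList, by omega, fun t ht => ?_, fun x y hxy => ?_,
    fun n c h1 hn hi hc => ?_⟩
  · obtain ⟨h, d, hd, h'⟩ := hF.1 ht
    refine ⟨hlt hd, ?_, h⟩
    rcases h' with h' | ⟨h', -⟩
    · exact hlt (Or.inl h')
    · omega
  · obtain ⟨w, hw, h⟩ := (hL.iff x y).1 hxy
    have key : ∀ (w : List Instr) (q : ℕ) (d : σ) (x : TapeHead), w ≠ [] → (∀ l ∈ w, l ∈ s) →
        Rep q d → D.evalFrom d w ∈ D.accept → ExecWord w x y →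
        Relation.TransGen (TableStep hS.toFinset.toList) (q, x) (1, y) := by
      intro w
      induction w with
      | nil => intro _ _ _ h; exact (h rfl).elim
      | cons l w ih =>
        rintro q d x - hs hd hw ⟨z, hz, h⟩
        have hl := hs l (by simp)
        rcases eq_or_ne w [] with rfl | hne
        · obtain rfl : y = z := h
          exact .single ⟨l, hF.2 ⟨hl, d, hd, Or.inr ⟨rfl, hw⟩⟩, hz⟩
        · refine .head (b := (2 + (e (D.step d l) : ℕ), z))
            ⟨l, hF.2 ⟨hl, d, hd, Or.inl rfl⟩, hz⟩ ?_
          exact ih _ _ _ hne (fun l hl => hs l (by simp [hl])) (Or.inl rfl) hw h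
    refine key w 1 D.start x (fun h => h0 (h ▸ hw)) (hL.letters_mem w hw) (Or.inr ⟨rfl, rfl⟩) ?_ h
    rw [← hD] at hw
    exact hw
  · have key : ∀ (n : ℕ) (c : ℕ → ℕ × TapeHead) (d : σ), Rep (c 0).1 d → (c (n + 1)).1 = 1 →
        (∀ i < n, (c (i + 1)).1 ≠ 1) →
        (∀ i ≤ n, TableStep hS.toFinset.toList (c i) (c (i + 1))) →
        ∃ w, D.evalFrom d w ∈ D.accept ∧ ExecWord w (c 0).2 (c (n + 1)).2 := by
      intro n
      induction n with
      | zero =>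
        intro c d hd h1 _ hc
        obtain ⟨l, hl, hx⟩ := hc 0 le_rfl
        obtain ⟨-, d', hd', h⟩ := hF.1 hl
        obtain rfl := hRep hd hd'
        refine ⟨[l], ?_, _, hx, rfl⟩
        rcases h with h | h
        · simp only at h h1; omega
        · exact h.2
      | succ n ih =>
        intro c d hd h1 hi hc
        obtain ⟨l, hl, hx⟩ := hc 0 (by omega)
        obtain ⟨-, d', hd', h⟩ := hF.1 hl
        obtain rfl := hRep hd hd'
        rcases h with h | h
        · obtain ⟨w, hw, hx'⟩ := ih (fun i => c (i + 1)) (D.step d l) (Or.inl h) h1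
            (fun i h => hi (i + 1) (by omega)) (fun i h => hc (i + 1) (by omega))
          exact ⟨l :: w, hw, _, hx, hx'⟩
        · exact (hi 0 (by omega) h.1).elim
    obtain ⟨w, hw, hx⟩ := key n c D.start (Or.inr ⟨h1, rfl⟩) hn hi hc
    refine (hL.iff _ _).2 ⟨w, ?_, hx⟩
    rw [← hD]
    exact hw

theorem finite_instrs (k : ℕ) : (instrs k).Finite :=
  ((Set.finite_Iic (blankSymbol k)).prod
    ((Set.finite_Iio (blankSymbol k)).prod (Set.finite_univ (α := Bool)))).subset
    fun _ hl => ⟨hl.1, hl.2, trivial⟩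

/-- Extension of a machine by states that write the register contents `(a, 0, …, 0)` on the
tape. -/
def loader (K m m₀ N a : ℕ) : Table :=
  (List.range (K + 1)).map (fun s => ((0, s), (N + a, m, true))) ++
  (List.range (K + 1)).map (fun s => ((N, s), (1, 0, false))) ++
  (List.range a).flatMap fun j =>
    (List.range (K + 1)).map fun s => ((N + j + 1, s), (N + j, m₀, true))

theorem mem_loader {K m m₀ N a : ℕ} {t : (ℕ × ℕ) × (ℕ × ℕ × Bool)} :
    t ∈ loader K m m₀ N a ↔ t.1.2 ≤ K ∧ (t.1.1 = 0 ∧ t.2 = (N + a, m, true) ∨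
      t.1.1 = N ∧ t.2 = (1, 0, false) ∨ ∃ j < a, t.1.1 = N + j + 1 ∧ t.2 = (N + j, m₀, true)) := by
  obtain ⟨⟨q, s⟩, t⟩ := t
  simp only [loader, List.mem_append, List.mem_map, List.mem_range, List.mem_flatMap,
    Prod.mk.injEq, Nat.lt_succ_iff]
  constructor
  · rintro ((⟨_, h, ⟨rfl, rfl⟩, rfl⟩ | ⟨_, h, ⟨rfl, rfl⟩, rfl⟩) |
      ⟨j, hj, _, h, ⟨rfl, rfl⟩, rfl⟩)
    · exact ⟨h, Or.inl ⟨rfl, rfl⟩⟩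
    · exact ⟨h, Or.inr (Or.inl ⟨rfl, rfl⟩)⟩
    · exact ⟨h, Or.inr (Or.inr ⟨j, hj, rfl, rfl⟩)⟩
  · rintro ⟨h, ⟨rfl, rfl⟩ | ⟨rfl, rfl⟩ | ⟨j, hj, rfl, rfl⟩⟩
    · exact Or.inl (Or.inl ⟨s, h, ⟨rfl, rfl⟩, rfl⟩)
    · exact Or.inl (Or.inr ⟨s, h, ⟨rfl, rfl⟩, rfl⟩)
    · exact Or.inr ⟨j, hj, s, h, ⟨rfl, rfl⟩, rfl⟩

theorem tableStep_iff_of_unique {F : Table} {q q' b : ℕ} {d : Bool} {T : ℕ → ℕ} {h : ℕ}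
    (hF : ∀ t, ((q, T h), t) ∈ F ↔ t = (q', b, d)) (hd : d = true ∨ 1 ≤ h) (z : ℕ × TapeHead) :
    TableStep F (q, (T, h)) z ↔ z = (q', (update T h b, if d then h + 1 else h - 1)) := by
  constructor
  · rintro ⟨⟨s, l⟩, hM, rfl, -, hz⟩
    obtain ⟨hq, rfl⟩ := Prod.mk.injEq .. ▸ (hF _).1 hM
    exact Prod.ext hq hz
  · rintro rfl
    exact ⟨(T h, b, d), (hF _).2 rfl, rfl, hd, rfl⟩

theorem TableStep.mono {F G : Table} (h : F ⊆ G) {a b : ℕ × TapeHead} (hab : TableStep F a b) :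
    TableStep G a b :=
  let ⟨l, hl, hx⟩ := hab
  ⟨l, h hl, hx⟩

theorem Realizes.exists_table_recurs_iff {s : Set Instr} (hs : s.Finite) {L : Language Instr}
    {r : TapeHead → TapeHead → Prop} (hL : Realizes s L r) (h0 : [] ∉ L) :
    ∃ (N : ℕ) (F : Table), 2 ≤ N ∧
      (∀ e ∈ F, (1 ≤ e.1.1 ∧ e.1.1 < N) ∧ (1 ≤ e.2.1 ∧ e.2.1 < N) ∧ (e.1.2, e.2.2) ∈ s) ∧
      ∀ G : Table, (∀ e ∈ G, e.1.1 = 0 ∨ N ≤ e.1.1) → ∀ x,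
        Recurs (TableStep (F ++ G)) (fun a => a.1 = 1) (1, x) ↔
          ∃ y : ℕ → TapeHead, y 0 = x ∧ ∀ i, r (y i) (y (i + 1)) := by
  obtain ⟨N, F, hN, hF, hr, hloop⟩ := hL.exists_table hs h0
  refine ⟨N, F, hN, hF, fun G hG x => ⟨fun h => ?_, ?_⟩⟩
  · have hstep : ∀ {a b}, TableStep (F ++ G) a b → 1 ≤ a.1 ∧ a.1 < N →
        TableStep F a b ∧ 1 ≤ b.1 ∧ b.1 < N := by
      rintro a b ⟨l, hl, hx⟩ ha
      rcases List.mem_append.1 hl with hl | hl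
      · exact ⟨⟨l, hl, hx⟩, (hF _ hl).2.1⟩
      · have := hG _ hl
        simp only at this
        omega
    have key : ∀ x : {x // Recurs (TableStep (F ++ G)) (fun a => a.1 = 1) (1, x)},
        ∃ y : {x // Recurs (TableStep (F ++ G)) (fun a => a.1 = 1) (1, x)}, r x.1 y.1 := by
      rintro ⟨x, c, h0, hc, h1⟩
      have hin : ∀ i, 1 ≤ (c i).1 ∧ (c i).1 < N := fun i => by
        induction i with
        | zero => rw [h0]; simp only; omega
        | succ i ih => exact (hstep (hc i) ih).2
      have hex : ∃ n, (c (n + 1)).1 = 1 := by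
        obtain ⟨i, hi, h⟩ := h1 1
        exact ⟨i - 1, by rwa [Nat.sub_add_cancel hi]⟩
      classical
      have hn := Nat.find_spec hex
      refine ⟨⟨(c (Nat.find hex + 1)).2, fun i => c (i + (Nat.find hex + 1)), ?_, fun i => ?_,
        fun M => ?_⟩, ?_⟩
      · simp only [Nat.zero_add]; exact Prod.ext hn rfl
      · have := hc (i + (Nat.find hex + 1))
        rwa [Nat.add_right_comm] at this
      · obtain ⟨i, hi, h⟩ := h1 (M + (Nat.find hex + 1))
        refine ⟨i - (Nat.find hex + 1), by omega, ?_⟩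
        simp only [Nat.sub_add_cancel (show Nat.find hex + 1 ≤ i by omega)]
        exact h
      · have := hloop (Nat.find hex) c (by rw [h0]) hn (fun i hi => Nat.find_min hex hi)
          fun i _ => (hstep (hc i) (hin i)).1
        rwa [h0] at this
    choose g hg using key
    exact ⟨fun i => (g^[i] ⟨x, h⟩).1, rfl, fun i => by
      simp only [iterate_succ_apply']; exact hg _⟩
  · rintro ⟨y, rfl, hy⟩
    exact recurs_of_transGen (u := fun i => (1, y i))
      (fun i => Relation.TransGen.mono
        (fun _ _ => TableStep.mono (List.subset_append_left _ _)) _ _ (hr _ _ (hy i)))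
      fun _ => rfl

theorem Simulates.exists_iterates_iff {k : ℕ} {p : Prog} {r : TapeHead → TapeHead → Prop}
    (h : Simulates k p r) {x : TapeHead} {σ : ℕ → ℕ} (hx : HasMarks k x.1 (unary k σ)) :
    (∃ y : ℕ → TapeHead, y 0 = x ∧ ∀ i, r (y i) (y (i + 1))) ↔
      ∃ s : ℕ → ℕ → ℕ, s 0 = σ ∧ ∀ i, p.Run (s i) (s (i + 1)) := by
  constructor
  · rintro ⟨y, rfl, hy⟩
    have key : ∀ (i : ℕ) (τ : {τ // HasMarks k (y i).1 (unary k τ)}),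
        ∃ τ' : {τ // HasMarks k (y (i + 1)).1 (unary k τ)}, p.Run τ.1 τ'.1 := by
      rintro i ⟨τ, hτ⟩
      obtain ⟨τ', h₁, h₂⟩ := h.sound _ _ _ _ hτ (hy i)
      exact ⟨⟨τ', h₂⟩, h₁⟩
    choose g hg using key
    let u : ∀ i, {τ // HasMarks k (y i).1 (unary k τ)} := fun i => i.rec ⟨σ, hx⟩ g
    exact ⟨fun i => (u i).1, rfl, fun i => hg i (u i)⟩
  · rintro ⟨s, rfl, hs⟩
    have key : ∀ (i : ℕ) (x : {x : TapeHead // HasMarks k x.1 (unary k (s i))}),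
        ∃ y : {x : TapeHead // HasMarks k x.1 (unary k (s (i + 1)))}, r x.1 y.1 := by
      rintro i ⟨x, hx⟩
      obtain ⟨y, h₁, h₂⟩ := h.complete _ x.2 _ _ hx (hs i)
      exact ⟨⟨y, h₂⟩, h₁⟩
    choose g hg using key
    let u : ∀ i, {x : TapeHead // HasMarks k x.1 (unary k (s i))} := fun i => i.rec ⟨x, hx⟩ g
    exact ⟨fun i => (u i).1, rfl, fun i => hg i (u i)⟩

section

variable {k m₀ N a : ℕ} {F : Table}

theorem HasMarks.le {T : ℕ → ℕ} {C : ℕ → Set ℕ} (hT : HasMarks k T C) (i : ℕ) :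
    T i ≤ blankSymbol k := by
  rcases Nat.eq_zero_or_pos i with rfl | hi
  · rw [hT.1, marker, blankSymbol]; omega
  · exact (hT.2 i hi).2.1

theorem HasMarks.update {T : ℕ → ℕ} {C C' : ℕ → Set ℕ} {h s : ℕ} (hT : HasMarks k T C)
    (h1 : 1 ≤ h) (hs : s < 2 ^ (k + 1)) (hC : C' h = marks k s) (hC' : ∀ i ≠ h, C' i = C i) :
    HasMarks k (update T h s) C' := by
  refine ⟨?_, fun i hi => ?_⟩
  · rw [update_of_ne (by omega)]; exact hT.1
  · rcases eq_or_ne i h with rfl | hne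
    · simp only [update_self, marker, blankSymbol]
      exact ⟨by omega, by omega, hC.symm⟩
    · rw [update_of_ne hne, hC' i hne]; exact hT.2 i hi

theorem exists_loaded (hN : 2 ≤ N) (hF : ∀ e ∈ F, 1 ≤ e.1.1 ∧ e.1.1 < N)
    (hm₀ : m₀ < 2 ^ (k + 1)) {A : Set ℕ} (hA : marks k m₀ = A) (P : ℕ → Prop) {j : ℕ} (hj : j ≤ a)
    {T : ℕ → ℕ} {h : ℕ} (h1 : 1 ≤ h) (hT : HasMarks k T fun i => {r | r ∈ A ∧ i < h}) :
    ∃ x : TapeHead, HasMarks k x.1 (fun i => {r | r ∈ A ∧ i < h + j}) ∧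
      (Recurs (TableStep (F ++ loader (blankSymbol k) (marker k) m₀ N a)) (fun a => P a.1)
          (N + j, (T, h)) ↔
        Recurs (TableStep (F ++ loader (blankSymbol k) (marker k) m₀ N a)) (fun a => P a.1)
          (1, x)) := by
  induction j generalizing T h with
  | zero =>
    refine ⟨_, ?_, recurs_iff_of_unique (tableStep_iff_of_unique
      (q' := 1) (b := 0) (d := false) (fun t => ?_) (Or.inr h1))⟩
    · refine hT.update h1 (by positivity) ?_ fun i _ => rfl
      rw [marks_lt_two (by omega)]
      ext; simp
    · rw [List.mem_append, mem_loader]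
      constructor
      · rintro (h | ⟨-, ⟨h, -⟩ | ⟨-, h⟩ | ⟨j, -, h, -⟩⟩)
        · have := hF _ h; simp only at this; omega
        · simp only at h; omega
        · exact h
        · simp only at h; omega
      · rintro rfl
        exact Or.inr ⟨hT.le h, Or.inr (Or.inl ⟨rfl, rfl⟩)⟩
  | succ j ih =>
    obtain ⟨x, hx, ih⟩ := ih (T := Function.update T h m₀) (h := h + 1) (by omega) (by omega) <| by
      refine hT.update h1 hm₀ ?_ fun i hi => ?_
      · rw [hA]; ext; simp
      · ext r
        have : i < h + 1 ↔ i < h := by omega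
        simp [this]
    refine ⟨x, by rwa [Nat.add_right_comm] at hx, .trans ?_ ih⟩
    refine recurs_iff_of_unique (tableStep_iff_of_unique (q' := N + j) (b := m₀) (d := true)
      (fun t => ?_) (Or.inl rfl))
    rw [List.mem_append, mem_loader]
    constructor
    · rintro (h | ⟨-, ⟨h, -⟩ | ⟨h, -⟩ | ⟨j', -, h, h'⟩⟩)
      · have := hF _ h; simp only at this; omega
      · simp only at h; omega
      · simp only at h; omega
      · simp only at h h'
        rw [h', show j' = j by omega]
    · rintro rfl
      exact Or.inr ⟨hT.le h, Or.inr (Or.inr ⟨j, by omega, by simp only; omega, rfl⟩)⟩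

theorem exists_loaded_start (hN : 2 ≤ N) (hF : ∀ e ∈ F, 1 ≤ e.1.1 ∧ e.1.1 < N)
    (hm₀ : m₀ < 2 ^ (k + 1)) (hA : marks k m₀ = {0}) (hk : 2 ≤ k) (qr : ℕ) {w : List ℕ}
    (hw : IsWord w) (n : ℕ) :
    ∃ x : TapeHead, HasMarks k x.1 (unary k (pairRegs a 0)) ∧
      (RecurringFrom
          (n, blankSymbol k, F ++ loader (blankSymbol k) (marker k) m₀ N a) qr
          (startConfig (n, blankSymbol k, F ++ loader (blankSymbol k) (marker k) m₀ N a) w) ↔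
        Recurs (TableStep (F ++ loader (blankSymbol k) (marker k) m₀ N a)) (fun a => a.1 = qr)
          (1, x)) := by
  have hpow : 2 ≤ 2 ^ (k + 1) := by rw [pow_succ]; have := Nat.one_le_two_pow (n := k); omega
  have hT : ∀ i, (w ++ [blankSymbol k]).getD i (blankSymbol k) < 2 ∨
      (w ++ [blankSymbol k]).getD i (blankSymbol k) = blankSymbol k := by
    intro i
    rcases lt_or_ge i (w ++ [blankSymbol k]).length with hi | hi
    · rw [List.getD_eq_getElem _ _ hi]
      rcases List.mem_append.1 (List.getElem_mem hi) with h | h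
      · exact Or.inl (hw _ h)
      · exact Or.inr (List.mem_singleton.1 h)
    · exact Or.inr (List.getD_eq_default _ _ hi)
  have hT' : ∀ i, (w ++ [blankSymbol k]).getD i (blankSymbol k) ≤ blankSymbol k := fun i => by
    have := hT i
    simp only [blankSymbol] at this ⊢
    omega
  have hmarks : HasMarks k (update (fun i => (w ++ [blankSymbol k]).getD i (blankSymbol k)) 0
      (marker k)) fun i => {r | r ∈ ({0} : Set ℕ) ∧ i < 1} := by
    refine ⟨update_self .., fun i hi => ?_⟩
    rw [update_of_ne (by omega)]
    refine ⟨?_, hT' i, ?_⟩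
    · have := hT i
      simp only [blankSymbol, marker] at this ⊢
      omega
    · trans ∅
      · rcases hT i with h | h
        · exact marks_lt_two h
        · rw [h]; exact marks_blankSymbol k
      · ext r; simp; omega
  obtain ⟨x, hx, h⟩ := exists_loaded (a := a) hN hF hm₀ hA (fun q => q = qr) le_rfl le_rfl hmarks
  refine ⟨x, ?_, (recurringFrom_iff (by simp [startConfig])).trans (.trans ?_ h)⟩
  · refine ⟨hx.1, fun i hi => ?_⟩
    obtain ⟨h1, h2, h3⟩ := hx.2 i hi
    refine ⟨h1, h2, h3.trans (Set.ext fun r => ?_)⟩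
    rw [mem_unary, pairRegs]
    simp only [Set.mem_ofPred_eq, Set.mem_singleton_iff, update_apply]
    split_ifs <;> omega
  · refine recurs_iff_of_unique (tableStep_iff_of_unique (fun t => ?_) (Or.inl rfl))
    rw [List.mem_append, mem_loader]
    constructor
    · rintro (h | ⟨-, ⟨-, h⟩ | ⟨h, -⟩ | ⟨j, -, h, -⟩⟩)
      · have := hF _ h
        simp only [startConfig] at this; omega
      · exact h
      · simp only [startConfig] at h; omega
      · simp only [startConfig] at h; omega
    · rintro rfl
      exact Or.inr ⟨hT' 0, Or.inl ⟨rfl, rfl⟩⟩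

end

theorem primrec_loader (K m m₀ N : ℕ) : Primrec (loader K m m₀ N) := by
  have hc : ∀ n : ℕ, Primrec fun _ : ℕ × ℕ => n := fun n => Primrec.const n
  have hadd : Primrec₂ fun x y : ℕ => x + y := Primrec.nat_add
  have h1 : Primrec fun a : ℕ =>
      (List.range (K + 1)).map fun s => ((0, s), (N + a, m, true)) :=
    Primrec.list_map (Primrec.const _)
      (((Primrec.const 0).pair Primrec.snd).pair
        ((hadd.comp (Primrec.const N) Primrec.fst).pair
          ((Primrec.const m).pair (Primrec.const true))))
  have h2 : Primrec fun _ : ℕ =>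
      (List.range (K + 1)).map fun s => ((N, s), (1, 0, false)) := Primrec.const _
  have h3 : Primrec fun a : ℕ => (List.range a).flatMap fun j =>
      (List.range (K + 1)).map fun s => ((N + j + 1, s), (N + j, m₀, true)) := by
    have h4 : Primrec fun j : ℕ =>
        (List.range (K + 1)).map fun s => ((N + j + 1, s), (N + j, m₀, true)) :=
      Primrec.list_map (Primrec.const _)
        (((Primrec.succ.comp (hadd.comp (Primrec.const N) Primrec.fst)).pair Primrec.snd).pair
          ((hadd.comp (Primrec.const N) Primrec.fst).pair
            ((Primrec.const m₀).pair (Primrec.const true))))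
    exact Primrec.list_flatMap Primrec.list_range (h4.comp Primrec.snd)
  exact Primrec.list_append.comp (Primrec.list_append.comp h1 h2) h3

theorem pi11Hard_universallyNonRecurring : Pi11Hard fun p : NTM × ℕ =>
    NTM.WF p.1 ∧ p.2 < NTM.numStates p.1 ∧
      ∀ w : List ℕ, IsWord w → NonRecurringFrom p.1 p.2 (startConfig p.1 w) := by
  rintro q ⟨R, hR, hq⟩
  obtain ⟨p, hp⟩ := exists_prog_iterates hR
  obtain ⟨L, r, h0, hL, hsim⟩ := exists_simulates_nonempty (k := p.width + 2) p (by omega)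
  obtain ⟨N, F, hN, hF, hrec⟩ := hL.exists_table_recurs_iff (finite_instrs _) h0
  obtain ⟨m₀, hm₀, hA⟩ := exists_marks_eq (k := p.width + 2) (A := {0}) (by simp)
  refine ⟨fun a => ((N + a + 1, blankSymbol (p.width + 2),
    F ++ loader (blankSymbol (p.width + 2)) (marker (p.width + 2)) m₀ N a), 1), ?_, fun a => ?_⟩
  · exact (((Primrec.succ.comp (Primrec.nat_add.comp (Primrec.const N) Primrec.id)).pair
      ((Primrec.const _).pair (Primrec.list_append.comp (Primrec.const F)
        (primrec_loader _ _ _ _)))).pair (Primrec.const 1)).to_comp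
  · have key : ∀ w, IsWord w → (NonRecurringFrom (N + a + 1, blankSymbol (p.width + 2),
        F ++ loader (blankSymbol (p.width + 2)) (marker (p.width + 2)) m₀ N a) 1
        (startConfig (N + a + 1, blankSymbol (p.width + 2),
        F ++ loader (blankSymbol (p.width + 2)) (marker (p.width + 2)) m₀ N a) w) ↔ q a) := by
      intro w hw
      obtain ⟨x, hx, h⟩ := exists_loaded_start (a := a) hN (fun e he => (hF e he).1) hm₀ hA
        (by omega) 1 hw (N + a + 1)
      rw [NonRecurringFrom, h, hrec _ (fun e he => ?_), hsim.exists_iterates_iff hx, hp, hq]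
      · simp
      · obtain ⟨-, ⟨h, -⟩ | ⟨h, -⟩ | ⟨j, -, h, -⟩⟩ := mem_loader.1 he
        all_goals omega
    have hpow : 2 ≤ 2 ^ (p.width + 2 + 1) := by
      rw [pow_succ]; have := Nat.one_le_two_pow (n := p.width + 2); omega
    constructor
    · intro h
      refine ⟨⟨Nat.succ_pos _, ?_, fun e he => ?_⟩, ?_, fun w hw => (key w hw).2 h⟩
      · simp only [NTM.blank, blankSymbol]; omega
      · simp only [NTM.numStates, NTM.blank]
        rcases List.mem_append.1 he with he | he
        · obtain ⟨h1, h2, h3, h4⟩ := hF e he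
          exact ⟨by omega, h3, by omega, h4⟩
        · obtain ⟨h1, ⟨h2, h3⟩ | ⟨h2, h3⟩ | ⟨j, hj, h2, h3⟩⟩ := mem_loader.1 he
          all_goals
            rw [h2, h3]
            simp only [marker, blankSymbol] at h1 ⊢
            refine ⟨by omega, h1, by omega, by omega⟩
      · simp only [NTM.numStates]; omega
    · rintro ⟨-, -, h⟩
      exact (key [] (by simp [IsWord])).1 (h [] (by simp [IsWord]))

/-- An input word, a configuration, and the number of steps up to the next visit of a given
state. -/
abbrev TraceEntry : Type := List ℕ × Config × ℕ

def IsTraceStart (M : NTM) (x : TraceEntry) : Prop := IsWord x.1 ∧ x.2.1 = startConfig M x.1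

def IsTraceStep (M : NTM) (qr : ℕ) (x y : TraceEntry) : Prop :=
  NTM.Next M x.2.1 y.2.1 ∧ (x.2.2 = 0 ∧ x.2.1.2.2 = qr ∨ x.2.2 = y.2.2 + 1)

theorem exists_recurringFrom_iff {M : NTM} {qr : ℕ} :
    (∃ w, IsWord w ∧ RecurringFrom M qr (startConfig M w)) ↔
      ∃ x : ℕ → TraceEntry, IsTraceStart M (x 0) ∧ ∀ i, IsTraceStep M qr (x i) (x (i + 1)) := by
  classical
  constructor
  · rintro ⟨w, hw, c, h0, hc, hq⟩
    refine ⟨fun i => (w, c i, Nat.find (hq i) - i), ⟨hw, h0⟩, fun i => ⟨hc i, ?_⟩⟩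
    simp only
    obtain ⟨h1, h2⟩ := Nat.find_spec (hq i)
    obtain ⟨h3, h4⟩ := Nat.find_spec (hq (i + 1))
    rcases h1.eq_or_lt with h | h
    · rw [← h] at h2
      exact Or.inl ⟨by omega, h2⟩
    · have h5 := Nat.find_min' (hq i) ⟨by omega, h4⟩
      have h6 := Nat.find_min' (hq (i + 1)) ⟨h, h2⟩
      exact Or.inr (by omega)
  · rintro ⟨x, ⟨hw, h0⟩, hx⟩
    refine ⟨_, hw, fun i => (x i).2.1, h0, fun i => (hx i).1, fun N => ?_⟩
    obtain ⟨m, hm⟩ : ∃ m, (x N).2.2 = m := ⟨_, rfl⟩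
    induction m generalizing N with
    | zero =>
      rcases (hx N).2 with h | h
      · exact ⟨N, le_rfl, h.2⟩
      · omega
    | succ m ih =>
      rcases (hx N).2 with h | h
      · omega
      · obtain ⟨i, hi, h⟩ := ih (N + 1) (by omega)
        exact ⟨i, by omega, h⟩

section

variable {α : Type*} [Primcodable α] {M : α → NTM}

open Primrec

theorem primrecPred_wf : PrimrecPred NTM.WF := by
  have hc : PrimrecRel fun (e : (ℕ × ℕ) × (ℕ × ℕ × Bool)) (M : NTM) =>
      e.1.1 < M.1 ∧ e.1.2 ≤ M.2.1 ∧ e.2.1 < M.1 ∧ e.2.2.1 < M.2.1 :=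
    (nat_lt.comp (fst.comp (fst.comp fst)) (fst.comp snd)).and <|
      (nat_le.comp (snd.comp (fst.comp fst)) (fst.comp (snd.comp snd))).and <|
      (nat_lt.comp (fst.comp (snd.comp fst)) (fst.comp snd)).and <|
      nat_lt.comp (fst.comp (snd.comp (snd.comp fst))) (fst.comp (snd.comp snd))
  exact (nat_le.comp (const 1) fst).and <| (nat_le.comp (const 2) (fst.comp snd)).and <|
    hc.forall_mem_list.comp (snd.comp snd) .id

theorem primrecPred_next {ρ ρ' : α → Config} (hM : Primrec M) (hρ : Primrec ρ)
    (hρ' : Primrec ρ') : PrimrecPred fun a => NTM.Next (M a) (ρ a) (ρ' a) := by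
  have hc : PrimrecRel fun (e : (ℕ × ℕ) × (ℕ × ℕ × Bool)) (a : α) =>
      e.1 = ((ρ a).2.2, (ρ a).1.getD (ρ a).2.1 0) ∧ (e.2.2.2 = true ∨ 1 ≤ (ρ a).2.1) ∧
        ρ' a = ((ρ a).1.set (ρ a).2.1 e.2.2.1 ++ [(M a).2.1],
          if e.2.2.2 = true then (ρ a).2.1 + 1 else (ρ a).2.1 - 1, e.2.1) := by
    have hρ := hρ.comp (snd (α := (ℕ × ℕ) × (ℕ × ℕ × Bool)))
    have hh := fst.comp (snd.comp hρ)
    have hM := hM.comp (snd (α := (ℕ × ℕ) × (ℕ × ℕ × Bool)))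
    have hd : Primrec fun x : ((ℕ × ℕ) × (ℕ × ℕ × Bool)) × α => x.1.2.2.2 :=
      snd.comp (snd.comp (snd.comp fst))
    have hd' : PrimrecPred fun x : ((ℕ × ℕ) × (ℕ × ℕ × Bool)) × α => x.1.2.2.2 = true :=
      Primrec.eq.comp hd (const true)
    refine (Primrec.eq.comp (fst.comp fst)
      ((snd.comp (snd.comp hρ)).pair ((list_getD 0).comp (fst.comp hρ) hh))).and <|
      (hd'.or (nat_le.comp (const 1) hh)).and <| Primrec.eq.comp (hρ'.comp snd) <|
      (list_append.comp
        (list_set.comp (fst.comp hρ) (hh.pair (fst.comp (snd.comp (snd.comp fst)))))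
        (list_cons.comp (fst.comp (snd.comp hM)) (const []))).pair <|
      (Primrec.ite hd' (succ.comp hh) (pred.comp hh)).pair (fst.comp (snd.comp fst))
  refine (hc.exists_mem_list.comp (snd.comp (snd.comp hM)) .id).of_eq fun a => ?_
  constructor
  · rintro ⟨⟨_, q', b, d⟩, he, rfl, h⟩
    exact ⟨q', b, d, he, h⟩
  · rintro ⟨q', b, d, he, h⟩
    exact ⟨_, he, rfl, h⟩

theorem primrecPred_isTraceStart {x : α → TraceEntry} (hM : Primrec M) (hx : Primrec x) :
    PrimrecPred fun a => IsTraceStart (M a) (x a) := by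
  have hw : PrimrecPred IsWord := PrimrecPred.forall_mem_list (nat_lt.comp .id (const 2))
  exact (hw.comp (fst.comp hx)).and <| Primrec.eq.comp (fst.comp (snd.comp hx)) <|
    (list_append.comp (fst.comp hx) (list_cons.comp (fst.comp (snd.comp hM)) (const []))).pair
      (const (0, 0))

theorem primrecPred_isTraceStep {q : α → ℕ} {x y : α → TraceEntry} (hM : Primrec M)
    (hq : Primrec q) (hx : Primrec x) (hy : Primrec y) :
    PrimrecPred fun a => IsTraceStep (M a) (q a) (x a) (y a) :=
  (primrecPred_next hM (fst.comp (snd.comp hx)) (fst.comp (snd.comp hy))).and <|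
    ((Primrec.eq.comp (snd.comp (snd.comp hx)) (const 0)).and
      (Primrec.eq.comp (snd.comp (snd.comp (fst.comp (snd.comp hx)))) hq)).or <|
    Primrec.eq.comp (snd.comp (snd.comp hx)) (succ.comp (snd.comp (snd.comp hy)))

end

theorem pi11_universallyNonRecurring : Pi11 fun p : NTM × ℕ =>
    NTM.WF p.1 ∧ p.2 < NTM.numStates p.1 ∧
      ∀ w : List ℕ, IsWord w → NonRecurringFrom p.1 p.2 (startConfig p.1 w) := by
  classical
  let D : ℕ → TraceEntry := fun n => (Encodable.decode n : Option TraceEntry).getD default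
  have hD : Primrec D := Primrec.option_getD_default.comp .decode
  have hD' : ∀ x, D (Encodable.encode x) = x := fun x => by
    simp only [D, Encodable.encodek, Option.getD_some]
  refine ⟨fun p l => decide ((NTM.WF p.1 ∧ p.2 < NTM.numStates p.1) ∧ 2 ≤ l.length ∧
    ¬ (IsTraceStart p.1 (D (l.getD 0 0)) ∧
      IsTraceStep p.1 p.2 (D (l.getD (l.length - 2) 0)) (D (l.getD (l.length - 1) 0)))),
    ?_, fun p => ?_⟩
  · have hM : Primrec fun x : (NTM × ℕ) × List ℕ => x.1.1 := Primrec.fst.comp .fst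
    have hlen : Primrec fun x : (NTM × ℕ) × List ℕ => x.2.length :=
      Primrec.list_length.comp .snd
    have hget : ∀ {g : (NTM × ℕ) × List ℕ → ℕ}, Primrec g →
        Primrec fun x : (NTM × ℕ) × List ℕ => D (x.2.getD (g x) 0) :=
      fun hg => hD.comp ((Primrec.list_getD 0).comp .snd hg)
    refine (PrimrecPred.decide ?_).to_comp
    exact ((primrecPred_wf.comp hM).and (Primrec.nat_lt.comp (Primrec.snd.comp .fst)
      (Primrec.fst.comp hM))).and <| (Primrec.nat_le.comp (.const 2) hlen).and <|
      PrimrecPred.not <| (primrecPred_isTraceStart hM (hget (.const 0))).and <|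
      primrecPred_isTraceStep hM (Primrec.snd.comp .fst)
        (hget (Primrec.nat_sub.comp hlen (.const 2))) (hget (Primrec.nat_sub.comp hlen (.const 1)))
  · have hget : ∀ (f : ℕ → ℕ) (k i : ℕ), i < k → ((List.range k).map f).getD i 0 = f i :=
      fun f k i hi => by simp [hi]
    have key : (∀ w, IsWord w → NonRecurringFrom p.1 p.2 (startConfig p.1 w)) ↔
        ∀ f : ℕ → ℕ, ¬ (IsTraceStart p.1 (D (f 0)) ∧
          ∀ i, IsTraceStep p.1 p.2 (D (f i)) (D (f (i + 1)))) := by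
      rw [← not_exists]
      refine Iff.trans ?_ (not_congr
        ((exists_recurringFrom_iff (M := p.1) (qr := p.2)).trans ⟨?_, ?_⟩))
      · simp [NonRecurringFrom]
      · rintro ⟨x, h⟩
        exact ⟨fun i => Encodable.encode (x i), by simpa only [hD'] using h⟩
      · rintro ⟨f, h⟩
        exact ⟨fun i => D (f i), h⟩
    beta_reduce
    rw [← and_assoc, key]
    simp only [decide_eq_true_eq, List.length_map, List.length_range]
    constructor
    · rintro ⟨hp, h⟩ f
      by_cases h0 : IsTraceStart p.1 (D (f 0))
      · have h := h f
        simp only [h0, true_and, not_forall] at h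
        obtain ⟨i, hi⟩ := h
        refine ⟨i + 2, hp, by omega, fun h => hi ?_⟩
        have h := h.2
        rwa [hget _ _ _ (by omega), hget _ _ _ (by omega)] at h
      · refine ⟨2, hp, le_rfl, fun h => h0 ?_⟩
        have h := h.1
        rwa [hget _ _ _ (by omega)] at h
    · intro h
      refine ⟨?_, fun f hf => ?_⟩
      · obtain ⟨_, hp, -⟩ := h id
        exact hp
      · obtain ⟨k, -, hk, h⟩ := h f
        rw [hget _ _ _ (by omega), hget _ _ _ (by omega), hget _ _ _ (by omega)] at h
        refine h ⟨hf.1, ?_⟩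
        have := hf.2 (k - 2)
        rwa [show k - 2 + 1 = k - 1 by omega] at this

end ChaseTermination

namespace ChaseTermination

/-- Deciding, given a non-deterministic Turing machine `M` and a state `q_r`
of `M`, whether `M` is universally non-recurring through `q_r` (for every input word `w`, every
run of `M` on `w` features `q_r` only finitely many times) is `Π¹₁`-complete. -/
theorem universallyNonRecurring_Pi11Complete :
    Pi11Complete (fun p : NTM × ℕ =>
      NTM.WF p.1 ∧ p.2 < NTM.numStates p.1 ∧
      ∀ w : List ℕ, IsWord w → NonRecurringFrom p.1 p.2 (startConfig p.1 w)) := by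
  exact ⟨pi11_universallyNonRecurring, pi11Hard_universallyNonRecurring⟩

end ChaseTermination
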